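/- arXiv:2109.04972 — 2 statements merged into one kernel-verified Lean document; each statement's English description precedes it below -/
import Mathlib

section
/- For every integer n ≥ 3 and every δ > 0 there exists ε₄ = ε₄(n, δ) > 0 such that the following holds: if K ⊆ ℝⁿ is a C¹ ε₄-perturbation of a ball, then (∫_{∂K} H⁺ dH^{n-1})^{1/(n-2)} / Per(K)^{1/(n-1)} ≥ ((n-1)·H^{n-1}(S^{n-1}))^{1/(n-2)} / Per(B₁)^{1/(n-1)} − δ, where B₁ is the unit ball of ℝⁿ. -/
open MeasureTheory Metric Set Real
open scoped ENNReal RealInnerProductSpace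

noncomputable section

abbrev Euc (n : ℕ) := EuclideanSpace ℝ (Fin n)

/-- Divergence of a vector field on Euclidean space: trace of its Fréchet derivative. -/
def divg {n : ℕ} (W : Euc n → Euc n) (x : Euc n) : ℝ :=
  LinearMap.trace ℝ (Euc n) (fderiv ℝ W x).toLinearMap

/-- A bounded domain with smooth boundary, encoded by a smooth defining function `F`:
the domain is `{F < 0}` and its boundary is `{F = 0}`, on which `0` is a regular value. -/
structure SmoothBody (n : ℕ) where
  F : Euc n → ℝ
  smooth : ContDiff ℝ (⊤ : ℕ∞) F
  bounded : Bornology.IsBounded {x : Euc n | F x ≤ 0}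
  connected : IsConnected {x : Euc n | F x < 0}
  regular : ∀ x : Euc n, F x = 0 → gradient F x ≠ 0

namespace SmoothBody

variable {n : ℕ} (K : SmoothBody n)

/-- The (open) domain `K`. -/
def body : Set (Euc n) := {x : Euc n | K.F x < 0}

/-- The boundary `∂K`. -/
def bdry : Set (Euc n) := {x : Euc n | K.F x = 0}

/-- The outer unit normal to `∂K` (extended to a neighbourhood as the normalized
gradient of the defining function). -/
def normal (x : Euc n) : Euc n := ‖gradient K.F x‖⁻¹ • gradient K.F x

/-- The mean curvature of `∂K` (trace of the second fundamental form with respect to the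
outer unit normal), computed as the divergence of the unit normal field. -/
def meanCurv (x : Euc n) : ℝ := divg K.normal x

/-- The orthogonal projection onto the hyperplane orthogonal to `ν`, as a linear map. -/
def tangentProj (ν : Euc n) : Euc n →ₗ[ℝ] Euc n :=
  LinearMap.id - LinearMap.smulRight (innerSL ℝ ν).toLinearMap ν

/-- The shape operator (Weingarten map) of `∂K` at `x`, extended by `0` on the normal
direction: `P ∘ Dν ∘ P` with `P` the orthogonal projection on the tangent space
`(ν x)^⊥` of `∂K`. Its eigenvalues are the principal curvatures of `∂K` together
with one extra `0`. -/
def shapeOp (x : Euc n) : Euc n →ₗ[ℝ] Euc n :=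
  (tangentProj (K.normal x)) ∘ₗ (fderiv ℝ K.normal x).toLinearMap ∘ₗ (tangentProj (K.normal x))

/-- The nuclear norm `‖II‖₁` of the second fundamental form of `∂K` at `x`: the sum of the
absolute values of the principal curvatures (eigenvalues of the shape operator). -/
def nuclearNormII (x : Euc n) : ℝ :=
  let M := LinearMap.toMatrix (EuclideanSpace.basisFun (Fin n) ℝ).toBasis
      (EuclideanSpace.basisFun (Fin n) ℝ).toBasis (K.shapeOp x)
  if h : M.IsHermitian then ∑ i, |h.eigenvalues i| else 0

/-- The perimeter of `K`: the `(n-1)`-dimensional Hausdorff measure of `∂K`. -/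
def perim : ℝ := (μH[(n : ℝ) - 1] K.bdry).toReal

/-- `K` is a `C¹` `ε`-perturbation of a ball: for some `x̄ ∈ ℝⁿ`, the outer unit normal
satisfies `|ν(x) - (x - x̄)/|x - x̄|| ≤ ε` for every `x ∈ ∂K`. -/
def IsPerturbedBall (ε : ℝ) : Prop :=
  ∃ c : Euc n, ∀ x ∈ K.bdry, ‖K.normal x - ‖x - c‖⁻¹ • (x - c)‖ ≤ ε

end SmoothBody

/-- The area of the unit sphere `S^{n-1} ⊆ ℝⁿ`, i.e. its `(n-1)`-dimensional Hausdorff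
measure (which is also the perimeter of the unit ball `B₁`). -/
def sphereArea (n : ℕ) : ℝ := (μH[(n : ℝ) - 1] (sphere (0 : Euc n) 1)).toReal

section UniformlyDistributed

open Filter Topology

variable {X : Type*} [PseudoMetricSpace X] [SecondCountableTopology X] [MeasurableSpace X]
  [BorelSpace X]

/-- If all balls of radius `r` have `μ`-measure `g r` and `ν`-measure `h r`, then on open sets
`μ` is bounded by `ν` up to the factor `liminf g r / h r`. -/
theorem measure_isOpen_le_liminf_mul {μ ν : Measure X} [IsFiniteMeasure μ] [IsFiniteMeasure ν]
    {g h : ℝ → ℝ≥0∞} (hμ : ∀ x, ∀ r > 0, μ (ball x r) = g r)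
    (hν : ∀ x, ∀ r > 0, ν (ball x r) = h r) (hh : ∀ r > 0, h r ≠ 0)
    {u : ℕ → ℝ} (hu : ∀ k, 0 < u k) (hu0 : Tendsto u atTop (𝓝 0)) {U : Set X} (hU : IsOpen U) :
    μ U ≤ liminf (fun k ↦ g (u k) / h (u k)) atTop * ν U := by
  rcases isEmpty_or_nonempty X with hX | ⟨⟨x0⟩⟩
  · simp [Set.eq_empty_of_isEmpty U]
  have htop : ∀ r > 0, h r ≠ ∞ := fun r hr ↦ hν x0 r hr ▸ measure_ne_top _ _
  have hmeas : ∀ r : ℝ, MeasurableSet {p : X × X | p.2 ∈ U ∧ dist p.2 p.1 < r} := fun r ↦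
    ((hU.preimage continuous_snd).inter
      (isOpen_lt (continuous_snd.dist continuous_fst) continuous_const)).measurableSet
  have hsec : ∀ r x, Prod.mk x ⁻¹' {p : X × X | p.2 ∈ U ∧ dist p.2 p.1 < r} = U ∩ ball x r :=
    fun r x ↦ rfl
  have hmν : ∀ r : ℝ, Measurable fun x ↦ ν (U ∩ ball x r) := fun r ↦
    measurable_measure_prodMk_left (hmeas r)
  have hswap : ∀ r : ℝ, 0 < r → ∫⁻ x in U, ν (U ∩ ball x r) ∂μ ≤ g r * ν U := by
    intro r hr
    have hprod : MeasurableSet {p : X × X | p.1 ∈ U ∧ p.2 ∈ U ∧ dist p.2 p.1 < r} :=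
      (hU.preimage continuous_fst).measurableSet.inter (hmeas r)
    have h1 : ∫⁻ x in U, ν (U ∩ ball x r) ∂μ =
        (μ.prod ν) {p : X × X | p.1 ∈ U ∧ p.2 ∈ U ∧ dist p.2 p.1 < r} := by
      rw [Measure.prod_apply hprod, ← lintegral_indicator hU.measurableSet]
      congr 1 with x
      by_cases hx : x ∈ U
      · simp only [indicator_of_mem hx]
        congr 1 with y
        simp [hx]
      · simp [hx]
    rw [h1, Measure.prod_apply_symm hprod]
    calc _ ≤ ∫⁻ y, U.indicator (fun _ ↦ g r) y ∂ν := by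
          refine lintegral_mono fun y ↦ ?_
          by_cases hy : y ∈ U
          · rw [indicator_of_mem hy, ← hμ y r hr]
            refine measure_mono fun x hx ↦ ?_
            simpa [dist_comm] using hx.2.2
          · simp [hy]
      _ = g r * ν U := by rw [lintegral_indicator hU.measurableSet, setLIntegral_const]
  calc μ U = ∫⁻ _ in U, 1 ∂μ := by simp
    _ ≤ ∫⁻ x in U, liminf (fun k ↦ ν (U ∩ ball x (u k)) / h (u k)) atTop ∂μ := by
        refine setLIntegral_mono' hU.measurableSet fun x hx ↦ ?_
        obtain ⟨ρ, hρ, hsub⟩ := Metric.isOpen_iff.1 hU x hx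
        refine le_liminf_of_le (by isBoundedDefault) ?_
        filter_upwards [hu0.eventually (gt_mem_nhds hρ)] with k hk
        rw [inter_eq_self_of_subset_right ((ball_subset_ball hk.le).trans hsub), hν x _ (hu k),
          ENNReal.div_self (hh _ (hu k)) (htop _ (hu k))]
    _ ≤ liminf (fun k ↦ ∫⁻ x in U, ν (U ∩ ball x (u k)) / h (u k) ∂μ) atTop :=
        lintegral_liminf_le fun k ↦ (hmν _).div_const _
    _ ≤ liminf (fun k ↦ g (u k) / h (u k) * ν U) atTop := by
        refine liminf_le_liminf (Eventually.of_forall fun k ↦ ?_)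
        simp only [div_eq_mul_inv]
        rw [lintegral_mul_const _ (hmν _), mul_right_comm]
        gcongr
        exact hswap _ (hu k)
    _ = liminf (fun k ↦ g (u k) / h (u k)) atTop * ν U := by
        simp only [mul_comm _ (ν U)]
        exact ENNReal.liminf_const_mul_of_ne_top (measure_ne_top _ _)

/-- Two finite uniformly distributed measures are proportional. -/
theorem exists_eq_smul_of_uniformlyDistributed (μ ν : Measure X) [IsFiniteMeasure μ]
    [IsFiniteMeasure ν] {g h : ℝ → ℝ≥0∞} (hμ : ∀ x, ∀ r > 0, μ (ball x r) = g r)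
    (hν : ∀ x, ∀ r > 0, ν (ball x r) = h r) (hg : ∀ r > 0, g r ≠ 0) (hh : ∀ r > 0, h r ≠ 0) :
    ∃ κ : ℝ≥0∞, μ = κ • ν := by
  rcases isEmpty_or_nonempty X with hX | ⟨⟨x0⟩⟩
  · exact ⟨0, by simp [Measure.eq_zero_of_isEmpty]⟩
  have htop : ∀ r > 0, h r ≠ ∞ := fun r hr ↦ hν x0 r hr ▸ measure_ne_top _ _
  have htop' : ∀ r > 0, g r ≠ ∞ := fun r hr ↦ hμ x0 r hr ▸ measure_ne_top _ _
  let u : ℕ → ℝ := fun k ↦ 1 / ((k : ℝ) + 1)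
  have hu : ∀ k, 0 < u k := fun k ↦ Nat.one_div_pos_of_nat
  have hu0 : Tendsto u atTop (𝓝 0) := tendsto_one_div_add_atTop_nhds_zero_nat
  set κ := liminf (fun k ↦ g (u k) / h (u k)) atTop with hκ
  have hκ' : liminf (fun k ↦ h (u k) / g (u k)) atTop ≤ κ⁻¹ := by
    have : (fun k ↦ h (u k) / g (u k)) = fun k ↦ (g (u k) / h (u k))⁻¹ := by
      funext k
      rw [ENNReal.inv_div (Or.inl (htop _ (hu k))) (Or.inl (hh _ (hu k)))]
    rw [this, ← ENNReal.inv_limsup, ENNReal.inv_le_inv]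
    exact liminf_le_limsup
  have hopen : ∀ U : Set X, IsOpen U → μ U = κ * ν U := by
    intro U hU
    refine le_antisymm (measure_isOpen_le_liminf_mul hμ hν hh hu hu0 hU) ?_
    calc κ * ν U ≤ κ * (κ⁻¹ * μ U) := by
          gcongr
          exact (measure_isOpen_le_liminf_mul hν hμ hg hu hu0 hU).trans (by gcongr)
      _ ≤ 1 * μ U := by
          rw [← mul_assoc]
          gcongr
          exact ENNReal.mul_inv_le_one κ
      _ = μ U := one_mul _
  refine ⟨κ, ext_of_generate_finite _ BorelSpace.measurable_eq isPiSystem_isOpen ?_ ?_⟩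
  · intro U hU
    simpa using hopen U hU
  · simpa using hopen univ isOpen_univ

end UniformlyDistributed

section SphereMeasure

open scoped Pointwise

/-- Any two points of the unit sphere are exchanged by a linear isometry. -/
theorem exists_linearIsometryEquiv_image_ball {E : Type*} [NormedAddCommGroup E]
    [InnerProductSpace ℝ E] (x y : sphere (0 : E) 1) :
    ∃ e : E ≃ₗᵢ[ℝ] E, ∀ r : ℝ, (e : E → E) '' ((↑) '' ball x r) = (↑) '' ball y r := by
  have hxy : ‖(x : E)‖ = ‖(y : E)‖ := by simp
  refine ⟨(ℝ ∙ ((x : E) - y))ᗮ.reflection, fun r ↦ ?_⟩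
  have hx : (ℝ ∙ ((x : E) - y))ᗮ.reflection (x : E) = y := Submodule.reflection_sub hxy
  rw [Subtype.image_ball, Subtype.image_ball]
  have h1 := LinearIsometryEquiv.image_ball ((ℝ ∙ ((x : E) - y))ᗮ.reflection) (x : E) r
  have h2 := LinearIsometryEquiv.image_sphere ((ℝ ∙ ((x : E) - y))ᗮ.reflection) (0 : E) 1
  rw [hx] at h1
  rw [map_zero] at h2
  change _ '' (ball (x : E) r ∩ sphere 0 1) = ball (y : E) r ∩ sphere 0 1
  rw [Set.image_inter (LinearIsometryEquiv.injective _), h1, h2]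

variable {n : ℕ}

theorem toSphere_ball_eq (x y : sphere (0 : Euc n) 1) (r : ℝ) :
    (volume : Measure (Euc n)).toSphere (ball x r) =
      (volume : Measure (Euc n)).toSphere (ball y r) := by
  obtain ⟨e, he⟩ := exists_linearIsometryEquiv_image_ball x y
  rw [Measure.toSphere_apply' _ measurableSet_ball, Measure.toSphere_apply' _ measurableSet_ball,
    ← he r]
  have : Ioo (0 : ℝ) 1 • ((e : Euc n → Euc n) '' ((↑) '' ball x r)) =
      e '' (Ioo (0 : ℝ) 1 • ((↑) '' ball x r)) := by
    ext z
    simp only [Set.mem_smul, Set.mem_image]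
    constructor
    · rintro ⟨t, ht, _, ⟨w, hw, rfl⟩, rfl⟩
      exact ⟨t • w, ⟨t, ht, w, hw, rfl⟩, by simp⟩
    · rintro ⟨_, ⟨t, ht, w, hw, rfl⟩, rfl⟩
      exact ⟨t, ht, e w, ⟨w, hw, rfl⟩, by simp⟩
  rw [this, ← e.coe_toHomeomorph, Homeomorph.image_eq_preimage_symm]
  congr 1
  exact (e.symm.measurePreserving.measure_preimage_emb
    e.symm.toHomeomorph.measurableEmbedding _).symm

theorem hausdorffMeasure_sphere_ball_eq {d : ℝ} (hd : 0 ≤ d) (x y : sphere (0 : Euc n) 1) (r : ℝ) :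
    (μH[d] : Measure (sphere (0 : Euc n) 1)) (ball x r) = μH[d] (ball y r) := by
  obtain ⟨e, he⟩ := exists_linearIsometryEquiv_image_ball x y
  have hi : Isometry ((↑) : sphere (0 : Euc n) 1 → Euc n) := isometry_subtype_coe
  rw [← hi.hausdorffMeasure_image (Or.inl hd), ← hi.hausdorffMeasure_image (Or.inl hd), ← he r,
    e.isometry.hausdorffMeasure_image (Or.inl hd)]

/-- If finite, the Hausdorff measure on the sphere is a multiple of the cone measure. -/
theorem exists_hausdorffMeasure_eq_smul_toSphere {d : ℝ} (hd : 0 ≤ d)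
    [IsFiniteMeasure (μH[d] : Measure (sphere (0 : Euc n) 1))] :
    ∃ κ : ℝ≥0∞, (μH[d] : Measure (sphere (0 : Euc n) 1)) =
      κ • (volume : Measure (Euc n)).toSphere := by
  rcases eq_or_ne (μH[d] : Measure (sphere (0 : Euc n) 1)) 0 with h0 | h0
  · exact ⟨0, by simp [h0]⟩
  rcases isEmpty_or_nonempty (sphere (0 : Euc n) 1) with hX | ⟨⟨x0⟩⟩
  · exact ⟨0, by simp [Measure.eq_zero_of_isEmpty]⟩
  refine exists_eq_smul_of_uniformlyDistributed _ _ (g := fun r ↦ μH[d] (ball x0 r))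
    (h := fun r ↦ (volume : Measure (Euc n)).toSphere (ball x0 r))
    (fun x r _ ↦ hausdorffMeasure_sphere_ball_eq hd x x0 r) (fun x r _ ↦ toSphere_ball_eq x x0 r)
    (fun r hr h ↦ h0 ?_) (fun r hr ↦ (measure_ball_pos _ _ hr).ne')
  refine Measure.measure_univ_eq_zero.1 (measure_null_of_locally_null _ fun x _ ↦
    ⟨ball x r, mem_nhdsWithin_of_mem_nhds (ball_mem_nhds x hr), ?_⟩)
  rw [hausdorffMeasure_sphere_ball_eq hd x x0 r, h]

end SphereMeasure

section SphereDivergence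

variable {n : ℕ}

/-- Integration in polar coordinates of a product of a radial and an angular function. -/
theorem integral_norm_mul_normalize [NeZero n] (g : Euc n → ℝ) (h : ℝ → ℝ) :
    ∫ x : Euc n, h ‖x‖ * g (‖x‖⁻¹ • x) =
      (∫ ω : sphere (0 : Euc n) 1, g ω ∂(volume : Measure (Euc n)).toSphere) *
        ∫ t in Ioi (0 : ℝ), t ^ (n - 1) * h t := by
  have hdim : Module.finrank ℝ (Euc n) = n := by simp
  calc ∫ x : Euc n, h ‖x‖ * g (‖x‖⁻¹ • x)
      = ∫ x : ({(0)}ᶜ : Set (Euc n)), h ‖x.1‖ * g (‖x.1‖⁻¹ • x.1)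
          ∂(volume.comap Subtype.val) := by
        rw [integral_subtype_comap (measurableSet_singleton _).compl
          fun x : Euc n ↦ h ‖x‖ * g (‖x‖⁻¹ • x), restrict_compl_singleton]
    _ = ∫ x, g x.1 * h x.2 ∂(volume : Measure (Euc n)).toSphere.prod
          (.volumeIoiPow (Module.finrank ℝ (Euc n) - 1)) := by
        rw [← (volume : Measure (Euc n)).measurePreserving_homeomorphUnitSphereProd.integral_comp
          (Homeomorph.measurableEmbedding _)]
        simp [mul_comm]
    _ = (∫ ω : sphere (0 : Euc n) 1, g ω ∂(volume : Measure (Euc n)).toSphere) *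
          ∫ t : Ioi (0 : ℝ), h t ∂.volumeIoiPow (Module.finrank ℝ (Euc n) - 1) :=
        integral_prod_mul (fun ω : sphere (0 : Euc n) 1 ↦ g ω) (fun t : Ioi (0 : ℝ) ↦ h t)
    _ = _ := by
        simp only [Measure.volumeIoiPow, ENNReal.ofReal, hdim]
        rw [integral_withDensity_eq_integral_smul,
          integral_subtype_comap measurableSet_Ioi fun a ↦ Real.toNNReal (a ^ (n - 1)) • h a,
          setIntegral_congr_fun measurableSet_Ioi fun x hx ↦ ?_]
        · rw [NNReal.smul_def, Real.coe_toNNReal _ (pow_nonneg (le_of_lt hx) _), smul_eq_mul]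
        · exact (measurable_subtype_coe.pow_const _).real_toNNReal

theorem divg_eq_sum (W : Euc n → Euc n) (x : Euc n) :
    divg W x = ∑ i, inner ℝ (EuclideanSpace.basisFun (Fin n) ℝ i)
      (fderiv ℝ W x (EuclideanSpace.basisFun (Fin n) ℝ i)) :=
  LinearMap.trace_eq_sum_inner _ (EuclideanSpace.basisFun (Fin n) ℝ)

theorem integrable_fderiv_apply {V : Euc n → Euc n} (hV : ContDiff ℝ 1 V)
    (hc : HasCompactSupport V) (v : Euc n) : Integrable fun x ↦ fderiv ℝ V x v :=
  ((hV.continuous_fderiv one_ne_zero).clm_apply continuous_const).integrable_of_hasCompactSupport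
    (hc.fderiv_apply ℝ v)

theorem integrable_divg {V : Euc n → Euc n} (hV : ContDiff ℝ 1 V)
    (hc : HasCompactSupport V) : Integrable (divg V) := by
  have : divg V = fun x ↦ ∑ i, inner ℝ (EuclideanSpace.basisFun (Fin n) ℝ i)
      (fderiv ℝ V x (EuclideanSpace.basisFun (Fin n) ℝ i)) := funext (divg_eq_sum V)
  rw [this]
  exact integrable_finsetSum _ fun i _ ↦ (integrable_fderiv_apply hV hc _).const_inner _

/-- The integral of the divergence of a compactly supported `C¹` field vanishes. -/
theorem integral_divg_eq_zero {V : Euc n → Euc n} (hV : ContDiff ℝ 1 V)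
    (hc : HasCompactSupport V) : ∫ x, divg V x = 0 := by
  have hint := integrable_fderiv_apply hV hc
  have hzero : ∀ v : Euc n, ∫ x, fderiv ℝ V x v = 0 := by
    intro v
    have := integral_smul_fderiv_eq_neg_fderiv_smul_of_integrable (μ := (volume : Measure (Euc n)))
      (𝕜 := ℝ) (f := fun _ ↦ (1 : ℝ)) (g := V) (v := v) (by simp) (by simpa using hint v)
      (by simpa using hV.continuous.integrable_of_hasCompactSupport hc)
      (fun x _ ↦ differentiableAt_const _) (fun x _ ↦ hV.differentiable one_ne_zero x)
    simpa using this
  simp only [divg_eq_sum]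
  rw [integral_finsetSum _ fun i _ ↦ (hint _).const_inner _]
  refine Finset.sum_eq_zero fun i _ ↦ ?_
  rw [integral_inner (hint _), hzero, inner_zero_right]

/-- Divergence of a field times a scalar. -/
theorem divg_smul {φ : Euc n → ℝ} {W : Euc n → Euc n} {x : Euc n} (hφ : DifferentiableAt ℝ φ x)
    (hW : DifferentiableAt ℝ W x) :
    divg (fun y ↦ φ y • W y) x = φ x * divg W x + fderiv ℝ φ x (W x) := by
  have h1 : divg (fun y ↦ φ y • W y) x = LinearMap.trace ℝ (Euc n)
      (φ x • (fderiv ℝ W x).toLinearMap + (fderiv ℝ φ x).toLinearMap.smulRight (W x)) := by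
    rw [divg, fderiv_fun_smul hφ hW]
    rfl
  rw [h1, map_add, map_smul, LinearMap.trace_smulRight]
  rfl

theorem divg_comp_smul (W : Euc n → Euc n) (t : ℝ) (x : Euc n) :
    divg (fun y ↦ W (t • y)) x = t * divg W (t • x) := by
  have : fderiv ℝ (fun y ↦ W (t • y)) x = t • fderiv ℝ W (t • x) := fderiv_comp_smul t
  rw [divg, this, divg]
  exact map_smul (LinearMap.trace ℝ (Euc n)) t _


end SphereDivergence

section SphereDivergenceTheorem

open Filter Topology

theorem hasFDerivAt_norm_of_ne_zero {E : Type*} [NormedAddCommGroup E] [InnerProductSpace ℝ E]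
    {x : E} (hx : x ≠ 0) : HasFDerivAt (fun y : E ↦ ‖y‖) (‖x‖⁻¹ • innerSL ℝ x) x := by
  have h := (hasStrictFDerivAt_norm_sq x).hasFDerivAt.sqrt (pow_ne_zero 2 (norm_ne_zero_iff.2 hx))
  have h' : HasFDerivAt (fun y : E ↦ ‖y‖) ((1 / (2 * √(‖x‖ ^ 2))) • 2 • innerSL ℝ x) x :=
    h.congr_of_eventuallyEq (Eventually.of_forall fun y ↦ by
      simp [Real.sqrt_sq (norm_nonneg y)])
  convert! h' using 1
  ext v
  simp [Real.sqrt_sq (norm_nonneg x)]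
  ring

theorem integral_Ioi_pow_mul_div {φ : ℝ → ℝ} (h0 : ∀ t ≤ 0, φ t = 0) (m : ℕ) :
    ∫ t in Ioi (0 : ℝ), t ^ (m + 1) * (φ t / t) = ∫ t, t ^ m * φ t := by
  rw [← setIntegral_eq_integral_of_forall_compl_eq_zero (s := Ioi (0 : ℝ))
    (f := fun t ↦ t ^ m * φ t)
    fun t ht ↦ by rw [h0 t (not_lt.1 ht), mul_zero]]
  refine setIntegral_congr_fun measurableSet_Ioi fun t (ht : 0 < t) ↦ ?_
  field_simp
  ring

/-- One-dimensional integration by parts against a power, on the half line. -/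
theorem integral_Ioi_pow_mul_deriv {φ : ℝ → ℝ} (hφ : ContDiff ℝ 1 φ) (hc : HasCompactSupport φ)
    (h0 : ∀ t ≤ 0, φ t = 0) (m : ℕ) :
    ∫ t in Ioi (0 : ℝ), t ^ (m + 1) * deriv φ t =
      -((m + 1) * ∫ t in Ioi (0 : ℝ), t ^ (m + 1) * (φ t / t)) := by
  have hdc : Continuous (deriv φ) := hφ.continuous_deriv le_rfl
  have hparts := integral_mul_deriv_eq_deriv_mul_of_integrable (u := fun t : ℝ ↦ t ^ (m + 1))
    (v := φ) (u' := fun t : ℝ ↦ ((m + 1 : ℕ) : ℝ) * t ^ m) (v' := deriv φ)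
    (fun t _ ↦ by simpa using hasDerivAt_pow (m + 1) t)
    (fun t _ ↦ (hφ.differentiable one_ne_zero t).hasDerivAt)
    (((continuous_pow _).mul hdc).integrable_of_hasCompactSupport (hc.deriv.mul_left))
    (((continuous_const.mul (continuous_pow _)).mul hφ.continuous).integrable_of_hasCompactSupport
      hc.mul_left)
    (((continuous_pow _).mul hφ.continuous).integrable_of_hasCompactSupport hc.mul_left)
  have hd0 : ∀ t ≤ 0, t ^ (m + 1) * deriv φ t = 0 := by
    intro t ht
    rcases ht.lt_or_eq with ht | rfl
    · have : φ =ᶠ[𝓝 t] fun _ ↦ (0 : ℝ) := by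
        filter_upwards [Iio_mem_nhds ht] with s hs using h0 s (le_of_lt hs)
      rw [this.deriv_eq]
      simp
    · simp
  have e1 : ∫ t in Ioi (0 : ℝ), t ^ (m + 1) * deriv φ t = ∫ t, t ^ (m + 1) * deriv φ t :=
    setIntegral_eq_integral_of_forall_compl_eq_zero fun t ht ↦ hd0 t (not_lt.1 ht)
  rw [e1, integral_Ioi_pow_mul_div h0 m, hparts]
  simp only [mul_assoc]
  rw [integral_const_mul]
  push_cast
  ring

variable {n : ℕ}

/-- The divergence theorem on the sphere for fields which are homogeneous of degree `0`. -/
theorem integral_sphere_divg {M : Euc n → Euc n} (hn : 2 ≤ n)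
    (hM : ∀ x, x ≠ 0 → ContDiffAt ℝ 1 M x) (hhom : ∀ t : ℝ, 0 < t → ∀ x, M (t • x) = M x) :
    ∫ ω : sphere (0 : Euc n) 1, divg M ω ∂(volume : Measure (Euc n)).toSphere =
      ((n : ℝ) - 1) * ∫ ω : sphere (0 : Euc n) 1, inner ℝ (M ω) (ω : Euc n)
        ∂(volume : Measure (Euc n)).toSphere := by
  have : NeZero n := ⟨by omega⟩
  obtain ⟨m, rfl⟩ : ∃ m, n = m + 2 := ⟨n - 2, by omega⟩
  let b : ContDiffBump (1 : ℝ) := ⟨1 / 4, 1 / 2, by norm_num, by norm_num⟩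
  let φ : ℝ → ℝ := b
  have hφ : ContDiff ℝ 1 φ := b.contDiff
  have hφ0 : ∀ t ≤ 1 / 2, φ t = 0 := fun t ht ↦ b.zero_of_le_dist <| by
    rw [Real.dist_eq, abs_of_nonpos (by linarith)]
    change (1 : ℝ) / 2 ≤ _
    linarith
  have hφ2 : ∀ t, 3 / 2 ≤ t → φ t = 0 := fun t ht ↦ b.zero_of_le_dist <| by
    rw [Real.dist_eq, abs_of_nonneg (by linarith)]
    change (1 : ℝ) / 2 ≤ _
    linarith
  have hφc : HasCompactSupport φ := b.hasCompactSupport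
  let V : Euc (m + 2) → Euc (m + 2) := fun x ↦ φ ‖x‖ • M x
  have hV0 : ∀ x : Euc (m + 2), ‖x‖ < 1 / 2 → V =ᶠ[𝓝 x] fun _ ↦ 0 := by
    intro x hx
    filter_upwards [(isOpen_lt continuous_norm continuous_const).mem_nhds hx] with y hy
    simp [V, hφ0 _ (le_of_lt hy)]
  have hV : ContDiff ℝ 1 V := by
    rw [contDiff_iff_contDiffAt]
    intro x
    rcases eq_or_ne x 0 with rfl | hx
    · exact contDiffAt_const.congr_of_eventuallyEq (hV0 0 (by simp))
    · exact (hφ.contDiffAt.comp x (contDiffAt_norm ℝ hx)).smul (hM x hx)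
  have hVc : HasCompactSupport V := by
    refine HasCompactSupport.intro (isCompact_closedBall 0 (3 / 2)) fun x hx ↦ ?_
    have : 3 / 2 ≤ ‖x‖ := by simpa using le_of_lt (by simpa using hx)
    simp [V, hφ2 _ this]
  let g₁ : Euc (m + 2) → ℝ := divg M
  let g₂ : Euc (m + 2) → ℝ := fun ω ↦ inner ℝ (M ω) ω
  have hdiv : ∀ x : Euc (m + 2), divg V x =
      φ ‖x‖ / ‖x‖ * g₁ (‖x‖⁻¹ • x) + deriv φ ‖x‖ * g₂ (‖x‖⁻¹ • x) := by
    intro x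
    rcases eq_or_ne x 0 with rfl | hx
    · have h1 : divg V 0 = 0 := by
        rw [divg, (hV0 0 (by simp)).fderiv_eq]
        simp
      simp [h1, g₂]
    · have hpos : 0 < ‖x‖ := norm_pos_iff.2 hx
      have hφx : HasFDerivAt (fun y : Euc (m + 2) ↦ φ ‖y‖)
          (deriv φ ‖x‖ • (‖x‖⁻¹ • innerSL ℝ x)) x :=
        (hφ.differentiable one_ne_zero _).hasDerivAt.comp_hasFDerivAt x
          (hasFDerivAt_norm_of_ne_zero hx)
      have h1 : divg V x = φ ‖x‖ * divg M x + deriv φ ‖x‖ * (‖x‖⁻¹ * inner ℝ x (M x)) := by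
        have := divg_smul hφx.differentiableAt ((hM x hx).differentiableAt one_ne_zero)
        rw [hφx.fderiv] at this
        simpa using this
      have h2 : divg M x = ‖x‖⁻¹ * divg M (‖x‖⁻¹ • x) := by
        rw [← divg_comp_smul]
        congr 1
        funext y
        rw [hhom _ (inv_pos.2 hpos)]
      rw [h1, h2]
      simp only [g₁, g₂, hhom _ (inv_pos.2 hpos), inner_smul_right, real_inner_comm]
      ring
  have hdφ0 : ∀ t < 1 / 2, deriv φ t = 0 := by
    intro t ht
    have : φ =ᶠ[𝓝 t] fun _ ↦ (0 : ℝ) := by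
      filter_upwards [Iio_mem_nhds ht] with s hs using hφ0 s (le_of_lt hs)
    rw [this.deriv_eq, deriv_const]
  have hdφ2 : ∀ t, 3 / 2 < t → deriv φ t = 0 := by
    intro t ht
    have : φ =ᶠ[𝓝 t] fun _ ↦ (0 : ℝ) := by
      filter_upwards [Ioi_mem_nhds ht] with s hs using hφ2 s (le_of_lt hs)
    rw [this.deriv_eq, deriv_const]
  have hint₂ : Integrable fun x : Euc (m + 2) ↦ deriv φ ‖x‖ * g₂ (‖x‖⁻¹ • x) := by
    refine Continuous.integrable_of_hasCompactSupport ?_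
      (HasCompactSupport.intro (isCompact_closedBall 0 (3 / 2)) fun x hx ↦ ?_)
    · rw [continuous_iff_continuousAt]
      intro x
      rcases eq_or_ne x 0 with rfl | hx
      · have : (fun x : Euc (m + 2) ↦ deriv φ ‖x‖ * g₂ (‖x‖⁻¹ • x)) =ᶠ[𝓝 0] fun _ ↦ 0 := by
          filter_upwards [ball_mem_nhds (0 : Euc (m + 2)) (ε := 1 / 2) (by norm_num)] with y hy
          rw [hdφ0 _ (by simpa using hy), zero_mul]
        exact continuousAt_const.congr this.symm
      · have hpos : 0 < ‖x‖ := norm_pos_iff.2 hx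
        have h1 : ContinuousAt (fun y : Euc (m + 2) ↦ ‖y‖⁻¹ • y) x :=
          (continuous_norm.continuousAt.inv₀ hpos.ne').smul continuousAt_id
        have h2 : ContinuousAt (fun y : Euc (m + 2) ↦ M (‖y‖⁻¹ • y)) x :=
          ContinuousAt.comp (g := M)
            (hM _ (smul_ne_zero (inv_ne_zero hpos.ne') hx)).continuousAt h1
        exact ((hφ.continuous_deriv le_rfl).comp continuous_norm).continuousAt.mul (h2.inner h1)
    · rw [hdφ2 _ (by simpa using hx), zero_mul]
  have hint₁ : Integrable fun x : Euc (m + 2) ↦ φ ‖x‖ / ‖x‖ * g₁ (‖x‖⁻¹ • x) := by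
    refine ((integrable_divg hV hVc).sub hint₂).congr (Eventually.of_forall fun x ↦ ?_)
    simp only [Pi.sub_apply]
    rw [hdiv, add_sub_cancel_right]
  have hsum := integral_divg_eq_zero hV hVc
  simp only [hdiv] at hsum
  rw [integral_add hint₁ hint₂, integral_norm_mul_normalize g₁ fun t ↦ φ t / t,
    integral_norm_mul_normalize g₂ (deriv φ)] at hsum
  have hA : 0 < ∫ t in Ioi (0 : ℝ), t ^ (m + 2 - 1) * (φ t / t) := by
    rw [show m + 2 - 1 = m + 1 from rfl, integral_Ioi_pow_mul_div fun t ht ↦ hφ0 t (by linarith)]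
    refine ((continuous_pow m).mul hφ.continuous).integral_pos_of_hasCompactSupport_nonneg_nonzero
      hφc.mul_left (fun t ↦ ?_) (x := 1) ?_
    · rcases le_total t (1 / 2) with ht | ht
      · simp [hφ0 t ht]
      · have : 0 ≤ φ t := b.nonneg
        positivity
    · have : φ 1 = 1 := b.one_of_mem_closedBall (by simp [b])
      simp [this]
  have hB := integral_Ioi_pow_mul_deriv hφ hφc (fun t ht ↦ hφ0 t (by linarith)) m
  rw [show m + 2 - 1 = m + 1 from rfl] at hsum hA
  rw [hB] at hsum
  set A := ∫ t in Ioi (0 : ℝ), t ^ (m + 1) * (φ t / t)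
  refine mul_right_cancel₀ hA.ne' ?_
  push_cast
  linear_combination hsum

end SphereDivergenceTheorem

section SphereHausdorff

variable {n : ℕ}

/-- The divergence theorem on the sphere for the Hausdorff measure. -/
theorem integral_hausdorffMeasure_sphere_divg {M : Euc n → Euc n} (hn : 2 ≤ n)
    (hM : ∀ x, x ≠ 0 → ContDiffAt ℝ 1 M x) (hhom : ∀ t : ℝ, 0 < t → ∀ x, M (t • x) = M x)
    [IsFiniteMeasure (μH[(n : ℝ) - 1] : Measure (sphere (0 : Euc n) 1))] :
    ∫ ω : sphere (0 : Euc n) 1, divg M ω ∂μH[(n : ℝ) - 1] =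
      ((n : ℝ) - 1) * ∫ ω : sphere (0 : Euc n) 1, inner ℝ (M ω) (ω : Euc n) ∂μH[(n : ℝ) - 1] := by
  have hd : (0 : ℝ) ≤ (n : ℝ) - 1 := by
    have : (2 : ℝ) ≤ n := by exact_mod_cast hn
    linarith
  obtain ⟨κ, hκ⟩ := exists_hausdorffMeasure_eq_smul_toSphere (n := n) hd
  rw [hκ, integral_smul_measure, integral_smul_measure, integral_sphere_divg hn hM hhom]
  simp only [smul_eq_mul]
  ring

end SphereHausdorff

namespace SmoothBody

section Radial

open Filter Topology

variable {n : ℕ} {K : SmoothBody n} {c : Euc n} {ε : ℝ}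

/-- The normal of `K` is `ε`-close to the radial direction from `c`. -/
def IsPerturbedBallAt (K : SmoothBody n) (c : Euc n) (ε : ℝ) : Prop :=
  ∀ x ∈ K.bdry, ‖K.normal x - ‖x - c‖⁻¹ • (x - c)‖ ≤ ε

/-- `r v` is the unique positive time at which the ray from `c` with velocity `v` meets `∂K`. -/
def IsRadius (K : SmoothBody n) (c : Euc n) (r : Euc n → ℝ) : Prop :=
  ∀ v, v ≠ 0 → 0 < r v ∧ ∀ t, 0 < t → (K.F (c + t • v) = 0 ↔ t = r v)

theorem norm_normal {x : Euc n} (hx : x ∈ K.bdry) : ‖K.normal x‖ = 1 := by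
  have : ‖gradient K.F x‖ ≠ 0 := norm_ne_zero_iff.2 (K.regular x hx)
  rw [normal, norm_smul, norm_inv, norm_norm, inv_mul_cancel₀ this]

theorem gradient_eq_norm_smul_normal {x : Euc n} (hx : x ∈ K.bdry) :
    gradient K.F x = ‖gradient K.F x‖ • K.normal x := by
  have : ‖gradient K.F x‖ ≠ 0 := norm_ne_zero_iff.2 (K.regular x hx)
  rw [normal, smul_smul, mul_inv_cancel₀ this, one_smul]

theorem fderiv_F_apply (x v : Euc n) : fderiv ℝ K.F x v = inner ℝ (gradient K.F x) v := by
  rw [gradient, InnerProductSpace.toDual_symm_apply]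

theorem IsPerturbedBallAt.ne_center (h : K.IsPerturbedBallAt c ε) (hε : ε < 1) {x : Euc n}
    (hx : x ∈ K.bdry) : x ≠ c := by
  rintro rfl
  have := h x hx
  rw [sub_self, smul_zero, sub_zero, norm_normal hx] at this
  linarith

theorem IsPerturbedBallAt.inner_normal_ge (h : K.IsPerturbedBallAt c ε) (hε : ε < 1) {x : Euc n}
    (hx : x ∈ K.bdry) : (1 - ε) * ‖x - c‖ ≤ inner ℝ (K.normal x) (x - c) := by
  have hpos : 0 < ‖x - c‖ := norm_pos_iff.2 (sub_ne_zero.2 (h.ne_center hε hx))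
  have h1 := real_inner_le_norm (‖x - c‖⁻¹ • (x - c) - K.normal x) (x - c)
  rw [inner_sub_left, real_inner_smul_left, real_inner_self_eq_norm_sq,
    norm_sub_rev _ (K.normal x)] at h1
  have h2 := mul_le_mul_of_nonneg_right (h x hx) hpos.le
  have h3 : ‖x - c‖⁻¹ * ‖x - c‖ ^ 2 = ‖x - c‖ := by field_simp
  linarith

theorem hasDerivAt_F_ray (v : Euc n) (t : ℝ) :
    HasDerivAt (fun s : ℝ ↦ K.F (c + s • v)) (inner ℝ (gradient K.F (c + t • v)) v) t := by
  have h1 : HasDerivAt (fun s : ℝ ↦ c + s • v) v t := by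
    simpa using ((hasDerivAt_id t).smul_const v).const_add c
  have h2 := ((K.smooth.differentiable (by simp)) (c + t • v)).hasFDerivAt.comp_hasDerivAt t h1
  rwa [fderiv_F_apply] at h2

theorem IsPerturbedBallAt.inner_gradient_pos (h : K.IsPerturbedBallAt c ε) (hε : ε < 1)
    {v : Euc n} {t : ℝ} (ht : 0 < t) (hx : K.F (c + t • v) = 0) :
    0 < inner ℝ (gradient K.F (c + t • v)) v := by
  have hx' : c + t • v ∈ K.bdry := hx
  have hne := h.ne_center hε hx'
  have h1 := h.inner_normal_ge hε hx'
  rw [add_sub_cancel_left, inner_smul_right] at h1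
  have h2 : 0 < ‖t • v‖ := norm_pos_iff.2 fun h0 ↦ hne (by rw [h0, add_zero])
  have h3 : 0 < t * inner ℝ (K.normal (c + t • v)) v :=
    lt_of_lt_of_le (mul_pos (by linarith) h2) h1
  rw [gradient_eq_norm_smul_normal hx', real_inner_smul_left]
  exact mul_pos (norm_pos_iff.2 (K.regular _ hx)) (pos_of_mul_pos_right h3 ht.le)

/-- A function of one variable that crosses zero only upwards stays nonnegative. -/
theorem nonneg_of_deriv_pos_of_zero {g g' : ℝ → ℝ} (hg : ∀ t, HasDerivAt g (g' t) t) {a b : ℝ}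
    (ha : 0 ≤ g a) (hpos : ∀ t, a ≤ t → g t = 0 → 0 < g' t) (hab : a ≤ b) : 0 ≤ g b := by
  have := image_le_of_deriv_right_lt_deriv_boundary' (f := fun t ↦ -g t) (f' := fun t ↦ -g' t)
    (B := fun _ ↦ 0) (B' := fun _ ↦ 0) (a := a) (b := b)
    (fun t _ ↦ (hg t).neg.continuousAt.continuousWithinAt)
    (fun t _ ↦ (hg t).neg.hasDerivWithinAt) (by simpa using ha) continuousOn_const
    (fun t _ ↦ hasDerivWithinAt_const _ _ _)
    (fun t ht h0 ↦ by simpa using hpos t ht.1 (by simpa using h0)) (right_mem_Icc.2 hab)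
  simpa using this

theorem pos_of_deriv_pos_of_zero {g g' : ℝ → ℝ} (hg : ∀ t, HasDerivAt g (g' t) t) {a b : ℝ}
    (ha : 0 ≤ g a) (hpos : ∀ t, a ≤ t → g t = 0 → 0 < g' t) (hab : a < b) : 0 < g b := by
  have hnn : ∀ t, a ≤ t → 0 ≤ g t := fun t ht ↦ nonneg_of_deriv_pos_of_zero hg ha hpos ht
  refine lt_of_le_of_ne (hnn b hab.le) fun h0 ↦ ?_
  have hmin : IsLocalMin g b := by
    filter_upwards [Ioi_mem_nhds hab] with t ht
    rw [← h0]
    exact hnn t (le_of_lt ht)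
  exact (hpos b hab.le h0.symm).ne' (hmin.hasDerivAt_eq_zero (hg b))

theorem IsPerturbedBallAt.F_center_neg (h : K.IsPerturbedBallAt c ε) (hε : ε < 1) : K.F c < 0 := by
  by_contra! hc
  have hc0 : K.F c ≠ 0 := fun h0 ↦ h.ne_center hε (x := c) h0 rfl
  obtain ⟨x, hx⟩ := K.connected.nonempty
  have := nonneg_of_deriv_pos_of_zero (g := fun s ↦ K.F (c + s • (x - c))) (a := 0) (b := 1)
    (fun t ↦ hasDerivAt_F_ray (x - c) t) (by simpa using hc) (fun t ht h0 ↦ ?_) zero_le_one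
  · simp only [one_smul, add_sub_cancel] at this
    exact absurd hx (not_lt.2 this)
  · refine h.inner_gradient_pos hε (lt_of_le_of_ne ht ?_) h0
    rintro rfl
    exact hc0 (by simpa using h0)

theorem IsPerturbedBallAt.exists_isRadius (h : K.IsPerturbedBallAt c ε) (hε : ε < 1) :
    ∃ r, K.IsRadius c r := by
  have key : ∀ v : Euc n, v ≠ 0 →
      ∃ s : ℝ, 0 < s ∧ ∀ t : ℝ, 0 < t → (K.F (c + t • v) = 0 ↔ t = s) := by
    intro v hv
    have hcont : Continuous fun t : ℝ ↦ K.F (c + t • v) :=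
      K.smooth.continuous.comp (by fun_prop)
    obtain ⟨C, hC⟩ := K.bounded.exists_norm_le
    have hvpos : 0 < ‖v‖ := norm_pos_iff.2 hv
    let T : ℝ := (|C| + ‖c‖ + 1) / ‖v‖
    have hT : 0 < T := by positivity
    have hFT : 0 < K.F (c + T • v) := by
      by_contra! hneg
      have h1 := hC _ hneg
      have h2 : ‖T • v‖ = |C| + ‖c‖ + 1 := by
        rw [norm_smul, Real.norm_of_nonneg hT.le, div_mul_cancel₀ _ hvpos.ne']
      have h3 : ‖T • v‖ ≤ ‖c + T • v‖ + ‖c‖ := by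
        simpa using norm_sub_le (c + T • v) c
      linarith [le_abs_self C]
    obtain ⟨s, hs, hs0⟩ : ∃ s ∈ Icc 0 T, K.F (c + s • v) = 0 := by
      have := intermediate_value_Icc hT.le hcont.continuousOn
      exact this ⟨by simpa using (h.F_center_neg hε).le, hFT.le⟩
    have hspos : 0 < s := by
      refine lt_of_le_of_ne hs.1 ?_
      rintro rfl
      exact (h.F_center_neg hε).ne (by simpa using hs0)
    have huniq : ∀ a b : ℝ, 0 < a → K.F (c + a • v) = 0 → a < b → K.F (c + b • v) ≠ 0 :=
      fun a b ha ha0 hab ↦ (pos_of_deriv_pos_of_zero (g := fun s ↦ K.F (c + s • v))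
        (fun t ↦ hasDerivAt_F_ray v t) ha0.ge
        (fun t ht h0 ↦ h.inner_gradient_pos hε (ha.trans_le ht) h0) hab).ne'
    refine ⟨s, hspos, fun t ht ↦ ⟨fun ht0 ↦ ?_, fun hts ↦ hts ▸ hs0⟩⟩
    rcases lt_trichotomy t s with hlt | heq | hgt
    · exact absurd hs0 (huniq t s ht ht0 hlt)
    · exact heq
    · exact absurd ht0 (huniq s t hspos hs0 hgt)
  choose! r hr using key
  exact ⟨r, hr⟩

end Radial

end SmoothBody

namespace SmoothBody

section RadialSmooth

open Filter Topology

variable {n : ℕ} {K : SmoothBody n} {c : Euc n} {ε : ℝ} {r : Euc n → ℝ}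

theorem contDiff_gradient : ContDiff ℝ 1 (gradient K.F) :=
  (InnerProductSpace.toDual ℝ (Euc n)).symm.contDiff.comp
    (K.smooth.fderiv_right (m := 1) (by norm_cast))

theorem contDiffAt_normal {x : Euc n} (hx : x ∈ K.bdry) : ContDiffAt ℝ 1 K.normal x := by
  have h1 : ContDiffAt ℝ 1 (gradient K.F) x := contDiff_gradient.contDiffAt
  have hne := K.regular x hx
  exact ((h1.norm ℝ hne).inv (norm_ne_zero_iff.2 hne)).smul h1

/-- The normal field is a unit field near the boundary. -/
theorem eventually_norm_normal {x : Euc n} (hx : x ∈ K.bdry) :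
    ∀ᶠ y in 𝓝 x, ‖K.normal y‖ = 1 := by
  filter_upwards [(contDiff_gradient (K := K)).continuous.continuousAt.eventually_ne
    (K.regular x hx)] with y hy
  rw [normal, norm_smul, norm_inv, norm_norm, inv_mul_cancel₀ (norm_ne_zero_iff.2 hy)]

theorem inner_fderiv_normal {x : Euc n} (hx : x ∈ K.bdry) (w : Euc n) :
    inner ℝ (K.normal x) (fderiv ℝ K.normal x w) = 0 := by
  have hd : HasFDerivAt K.normal (fderiv ℝ K.normal x) x :=
    ((contDiffAt_normal hx).differentiableAt one_ne_zero).hasFDerivAt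
  have h1 := hd.inner ℝ hd
  have h2 : HasFDerivAt (fun y ↦ inner ℝ (K.normal y) (K.normal y)) (0 : Euc n →L[ℝ] ℝ) x := by
    refine (hasFDerivAt_const (1 : ℝ) x).congr_of_eventuallyEq ?_
    filter_upwards [eventually_norm_normal hx] with y hy
    rw [real_inner_self_eq_norm_sq, hy, one_pow]
  have h3 := congrArg (fun L : Euc n →L[ℝ] ℝ ↦ L w) (h1.unique h2)
  simp only [ContinuousLinearMap.comp_apply, ContinuousLinearMap.prod_apply,
    fderivInnerCLM_apply, _root_.zero_apply] at h3
  rw [real_inner_comm (K.normal x)] at h3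
  linarith

theorem IsRadius.pos (hr : K.IsRadius c r) {v : Euc n} (hv : v ≠ 0) : 0 < r v := (hr v hv).1

theorem IsRadius.mem_bdry (hr : K.IsRadius c r) {v : Euc n} (hv : v ≠ 0) :
    c + r v • v ∈ K.bdry :=
  ((hr v hv).2 _ (hr.pos hv)).2 rfl

theorem IsRadius.apply_smul (hr : K.IsRadius c r) {v : Euc n} (hv : v ≠ 0) {t : ℝ} (ht : 0 < t) :
    r (t • v) = t⁻¹ * r v := by
  have hpos : 0 < t⁻¹ * r v := mul_pos (inv_pos.2 ht) (hr.pos hv)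
  refine (((hr (t • v) (smul_ne_zero ht.ne' hv)).2 _ hpos).1 ?_).symm
  rw [smul_smul, mul_right_comm, inv_mul_cancel₀ ht.ne', one_mul]
  exact hr.mem_bdry hv

theorem IsRadius.smul_apply_smul (hr : K.IsRadius c r) {t : ℝ} (ht : 0 < t) (v : Euc n) :
    r (t • v) • t • v = r v • v := by
  rcases eq_or_ne v 0 with rfl | hv
  · simp
  · rw [hr.apply_smul hv ht, smul_smul, mul_right_comm, inv_mul_cancel₀ ht.ne', one_mul]

theorem IsRadius.inner_gradient_pos (hr : K.IsRadius c r) (h : K.IsPerturbedBallAt c ε)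
    (hε : ε < 1) {v : Euc n} (hv : v ≠ 0) :
    0 < inner ℝ (gradient K.F (c + r v • v)) v :=
  h.inner_gradient_pos hε (hr.pos hv) (hr.mem_bdry hv)

theorem IsRadius.contDiffAt (hr : K.IsRadius c r) (h : K.IsPerturbedBallAt c ε)
    (hε : ε < 1) {v : Euc n} (hv : v ≠ 0) : ContDiffAt ℝ 1 r v := by
  let f : Euc n × ℝ → ℝ := fun p ↦ K.F (c + p.2 • p.1)
  have hF : ContDiff ℝ 1 K.F := K.smooth.of_le (by norm_cast)
  have hf : ContDiff ℝ 1 f := hF.comp (by fun_prop)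
  have cdf : ContDiffAt ℝ 1 f (v, r v) := hf.contDiffAt
  have hval : ∀ s : ℝ, (fderiv ℝ f (v, r v) ∘L .inr ℝ (Euc n) ℝ) s =
      s * inner ℝ (gradient K.F (c + r v • v)) v := by
    intro s
    have h1 : HasDerivAt (fun t : ℝ ↦ f (v, t)) (fderiv ℝ f (v, r v) (0, 1)) (r v) :=
      ((hf.differentiable one_ne_zero) (v, r v)).hasFDerivAt.comp_hasDerivAt (r v)
        ((hasDerivAt_const (r v) v).prodMk (hasDerivAt_id (r v)))
    rw [← h1.unique (hasDerivAt_F_ray v (r v)), ← smul_eq_mul, ← map_smul]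
    simp
  have hpos := hr.inner_gradient_pos h hε hv
  have hinv : (fderiv ℝ f (v, r v) ∘L .inr ℝ (Euc n) ℝ).IsInvertible := by
    refine ⟨ContinuousLinearEquiv.smulLeft (Units.mk0 _ hpos.ne'), ?_⟩
    ext
    rw [hval]
    simp [Units.smul_def]
  have hψ := cdf.contDiffAt_implicitFunction one_ne_zero hinv
  refine hψ.congr_of_eventuallyEq ?_
  have hs := cdf.implicitFunction_apply_self one_ne_zero hinv
  have hpos' : ∀ᶠ x in 𝓝 v, 0 < cdf.implicitFunction one_ne_zero hinv x :=
    hψ.continuousAt.eventually_const_lt (by simpa [hs] using hr.pos hv)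
  filter_upwards [cdf.eventually_apply_implicitFunction one_ne_zero hinv, hpos',
    eventually_ne_nhds hv] with x hx hxpos hx0
  refine (((hr x hx0).2 _ hxpos).1 ?_).symm
  rw [show K.F (c + cdf.implicitFunction one_ne_zero hinv x • x) = f (v, r v) from hx]
  exact hr.mem_bdry hv

theorem IsRadius.contDiffAt_normal_comp (hr : K.IsRadius c r) (h : K.IsPerturbedBallAt c ε)
    (hε : ε < 1) {v : Euc n} (hv : v ≠ 0) :
    ContDiffAt ℝ 1 (fun x ↦ K.normal (c + r x • x)) v :=
  ContDiffAt.comp (g := K.normal) v (contDiffAt_normal (hr.mem_bdry hv))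
    (contDiffAt_const.add ((hr.contDiffAt h hε hv).smul contDiffAt_id))

theorem IsRadius.inner_normal_pos (hr : K.IsRadius c r) (h : K.IsPerturbedBallAt c ε)
    (hε : ε < 1) {v : Euc n} (hv : v ≠ 0) :
    0 < inner ℝ (K.normal (c + r v • v)) v := by
  rw [normal, real_inner_smul_left]
  exact mul_pos (inv_pos.2 (norm_pos_iff.2 (K.regular _ (hr.mem_bdry hv))))
    (hr.inner_gradient_pos h hε hv)

theorem IsRadius.hasFDerivAt_smul (hr : K.IsRadius c r) (h : K.IsPerturbedBallAt c ε)
    (hε : ε < 1) {v : Euc n} (hv : v ≠ 0) :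
    HasFDerivAt (fun x ↦ c + r x • x)
      (r v • ContinuousLinearMap.id ℝ (Euc n) + (fderiv ℝ r v).smulRight v) v :=
  ((((hr.contDiffAt h hε hv).differentiableAt one_ne_zero).hasFDerivAt).smul
    (hasFDerivAt_id v)).const_add c

theorem IsRadius.fderiv_mul_inner (hr : K.IsRadius c r) (h : K.IsPerturbedBallAt c ε)
    (hε : ε < 1) {v : Euc n} (hv : v ≠ 0) (w : Euc n) :
    fderiv ℝ r v w * inner ℝ (K.normal (c + r v • v)) v =
      -(r v * inner ℝ (K.normal (c + r v • v)) w) := by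
  have h1 := ((K.smooth.differentiable (by simp)) (c + r v • v)).hasFDerivAt.comp v
    (hr.hasFDerivAt_smul h hε hv)
  have h2 : HasFDerivAt (K.F ∘ fun x ↦ c + r x • x) (0 : Euc n →L[ℝ] ℝ) v := by
    refine (hasFDerivAt_const (0 : ℝ) v).congr_of_eventuallyEq ?_
    filter_upwards [eventually_ne_nhds hv] with x hx
    exact hr.mem_bdry hx
  have h3 := congrArg (fun L : Euc n →L[ℝ] ℝ ↦ L w) (h1.unique h2)
  simp only [ContinuousLinearMap.comp_apply, _root_.add_apply,
    _root_.smul_apply, ContinuousLinearMap.id_apply,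
    ContinuousLinearMap.smulRight_apply, _root_.zero_apply] at h3
  rw [fderiv_F_apply, gradient_eq_norm_smul_normal (hr.mem_bdry hv), real_inner_smul_left] at h3
  have h4 := (mul_eq_zero.1 h3).resolve_left (norm_ne_zero_iff.2 (K.regular _ (hr.mem_bdry hv)))
  rw [inner_add_right, real_inner_smul_right, real_inner_smul_right] at h4
  linarith

/-- The divergence of the normal, pulled back along the radial parametrization. -/
theorem IsRadius.divg_normal (hr : K.IsRadius c r) (h : K.IsPerturbedBallAt c ε)
    (hε : ε < 1) {v : Euc n} (hv : v ≠ 0) :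
    divg (fun x ↦ K.normal (c + r x • x)) v = r v * K.meanCurv (c + r v • v) := by
  set x := c + r v • v with hx
  have hxm : x ∈ K.bdry := hr.mem_bdry hv
  have h1 := ((contDiffAt_normal hxm).differentiableAt one_ne_zero).hasFDerivAt.comp v
    (hr.hasFDerivAt_smul h hε hv)
  have h2 : (fderiv ℝ (fun y ↦ K.normal (c + r y • y)) v).toLinearMap =
      r v • (fderiv ℝ K.normal x).toLinearMap +
        (fderiv ℝ r v).toLinearMap.smulRight (fderiv ℝ K.normal x v) := by
    have h3 : fderiv ℝ (fun y ↦ K.normal (c + r y • y)) v = _ := h1.fderiv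
    ext1 w
    have h4 := congrArg (fun L : Euc n →L[ℝ] Euc n ↦ L w) h3
    simpa using h4
  have hne := (hr.inner_normal_pos h hε hv).ne'
  have h5 : fderiv ℝ r v (fderiv ℝ K.normal x v) = 0 := by
    have h6 := hr.fderiv_mul_inner h hε hv (fderiv ℝ K.normal x v)
    rw [inner_fderiv_normal hxm, mul_zero, neg_zero] at h6
    exact (mul_eq_zero.1 h6).resolve_right hne
  rw [divg, h2, map_add, map_smul, LinearMap.trace_smulRight, ContinuousLinearMap.coe_coe, h5,
    add_zero, meanCurv, divg, smul_eq_mul]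

end RadialSmooth

end SmoothBody

/-- In dimension at least three, two vectors have a common unit normal. -/
theorem exists_unit_orthogonal {n : ℕ} (hn : 3 ≤ n) (x y : Euc n) :
    ∃ z : Euc n, ‖z‖ = 1 ∧ inner ℝ x z = 0 ∧ inner ℝ y z = 0 := by
  have hlt : Module.finrank ℝ (Submodule.span ℝ {x, y}) < n := by
    have h1 := finrank_span_finset_le_card (R := ℝ) ({x, y} : Finset (Euc n))
    rw [Finset.coe_pair] at h1
    exact (h1.trans Finset.card_le_two).trans_lt (by lia)
  have hne : (Submodule.span ℝ {x, y})ᗮ ≠ ⊥ := by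
    intro h0
    rw [Submodule.orthogonal_eq_bot_iff] at h0
    rw [h0, finrank_top, finrank_euclideanSpace_fin] at hlt
    exact lt_irrefl n hlt
  obtain ⟨z, hz, hz0⟩ := Submodule.exists_mem_ne_zero_of_ne_bot hne
  have hx : inner ℝ x z = 0 := hz x (Submodule.subset_span (by simp))
  have hy : inner ℝ y z = 0 := hz y (Submodule.subset_span (by simp))
  refine ⟨‖z‖⁻¹ • z, norm_smul_inv_norm hz0, ?_, ?_⟩ <;>
    simp [real_inner_smul_right, hx, hy]

/-- A chord of the unit sphere between vectors at a non-obtuse angle stays away from the origin. -/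
theorem half_le_norm_of_mem_segment {E : Type*} [NormedAddCommGroup E] [InnerProductSpace ℝ E]
    {x y z : E} (hx : ‖x‖ = 1) (hy : ‖y‖ = 1) (hxy : 0 ≤ inner ℝ x y) (hz : z ∈ segment ℝ x y) :
    2⁻¹ ≤ ‖z‖ := by
  obtain ⟨a, b, ha, hb, hab, rfl⟩ := hz
  have h1 : ‖a • x + b • y‖ ^ 2 = a ^ 2 + 2 * (a * b * inner ℝ x y) + b ^ 2 := by
    rw [norm_add_sq_real, norm_smul, norm_smul, hx, hy, real_inner_smul_left,
      real_inner_smul_right, Real.norm_of_nonneg ha, Real.norm_of_nonneg hb]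
    ring
  have h2 : 0 ≤ a * b * inner ℝ x y := by positivity
  refine le_of_sq_le_sq ?_ (norm_nonneg _)
  rw [h1]
  obtain rfl : b = 1 - a := by linarith
  nlinarith [sq_nonneg (2 * a - 1)]

namespace SmoothBody

section LogRadius

variable {n : ℕ} {K : SmoothBody n} {c : Euc n} {ε : ℝ} {r : Euc n → ℝ}

theorem IsRadius.norm_normal_sub_le (hr : K.IsRadius c r) (h : K.IsPerturbedBallAt c ε)
    {v : Euc n} (hv : v ≠ 0) : ‖K.normal (c + r v • v) - ‖v‖⁻¹ • v‖ ≤ ε := by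
  have h1 := h _ (hr.mem_bdry hv)
  have hp := hr.pos hv
  rwa [add_sub_cancel_left, norm_smul, Real.norm_of_nonneg hp.le, smul_smul, mul_inv_rev,
    inv_mul_cancel_right₀ hp.ne'] at h1

theorem IsRadius.abs_logDeriv_le (hr : K.IsRadius c r) (h : K.IsPerturbedBallAt c ε)
    (hε : ε ≤ 2⁻¹) {v : Euc n} (hv : v ≠ 0) (w : Euc n) :
    |(r v)⁻¹ * fderiv ℝ r v w + ‖v‖⁻¹ * (‖v‖⁻¹ * inner ℝ v w)| ≤ 2 * ε / ‖v‖ * ‖w‖ := by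
  have hvpos : 0 < ‖v‖ := norm_pos_iff.2 hv
  have hrpos := hr.pos hv
  have h1 := hr.norm_normal_sub_le h hv
  have h2 := hr.fderiv_mul_inner h (by linarith) hv w
  have hν := norm_normal (hr.mem_bdry hv)
  have hapos := hr.inner_normal_pos h (by linarith) hv
  set ν := K.normal (c + r v • v)
  set u := ‖v‖⁻¹ • v with hu
  have hun : ‖u‖ = 1 := norm_smul_inv_norm hv
  have hvu : v = ‖v‖ • u := by rw [hu, smul_inv_smul₀ hvpos.ne']
  clear_value u
  set a : ℝ := inner ℝ ν u with ha
  have hνv : inner ℝ ν v = ‖v‖ * a := by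
    conv_lhs => rw [hvu, real_inner_smul_right]
  have hε0 : 0 ≤ ε := (norm_nonneg _).trans h1
  have h3 : 2 - 2 * a ≤ ε ^ 2 := by
    have := pow_le_pow_left₀ (norm_nonneg _) h1 2
    rw [norm_sub_sq_real, hν, hun] at this
    linarith
  have ha1 : 2⁻¹ ≤ a := by nlinarith
  have h4 : ‖a • u - ν‖ ≤ ε := by
    refine le_of_sq_le_sq ?_ hε0
    rw [norm_sub_sq_real, norm_smul, hν, hun, real_inner_smul_left, real_inner_comm, ← ha,
      mul_one, Real.norm_eq_abs, sq_abs]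
    nlinarith [sq_nonneg (1 - a)]
  have h5 : (r v)⁻¹ * fderiv ℝ r v w + ‖v‖⁻¹ * (‖v‖⁻¹ * inner ℝ v w) =
      inner ℝ (a • u - ν) w / (‖v‖ * a) := by
    have h6 : inner ℝ v w = ‖v‖ * inner ℝ u w := by
      conv_lhs => rw [hvu, real_inner_smul_left]
    rw [hνv] at h2
    have ha0 : a ≠ 0 := by positivity
    rw [h6, inner_sub_left, real_inner_smul_left, eq_div_iff (by positivity)]
    field_simp
    linear_combination h2
  rw [h5, abs_div, abs_of_pos (show 0 < ‖v‖ * a by positivity), div_mul_eq_mul_div,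
    div_le_div_iff₀ (by positivity) hvpos]
  have h7 : |inner ℝ (a • u - ν) w| ≤ ε * ‖w‖ :=
    (abs_real_inner_le_norm _ _).trans (by gcongr)
  have h8 : ε * ‖w‖ ≤ 2 * ε * ‖w‖ * a := by
    have : 0 ≤ ε * ‖w‖ := by positivity
    nlinarith
  calc _ ≤ 2 * ε * ‖w‖ * a * ‖v‖ := by gcongr; exact h7.trans h8
    _ = _ := by ring

theorem IsRadius.abs_log_sub_log_le_of_segment (hr : K.IsRadius c r) (h : K.IsPerturbedBallAt c ε)
    (hε : ε ≤ 2⁻¹) {x y : Euc n} (hx : ‖x‖ = 1) (hy : ‖y‖ = 1) (hxy : 0 ≤ inner ℝ x y) :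
    |log (r y) - log (r x)| ≤ 4 * ε * ‖y - x‖ := by
  have hε0 : 0 ≤ ε := by
    have hx0 : x ≠ 0 := by rintro rfl; simp at hx
    exact (norm_nonneg _).trans (hr.norm_normal_sub_le h hx0)
  have key := (convex_segment (𝕜 := ℝ) x y).norm_image_sub_le_of_norm_hasFDerivWithin_le
    (f := fun v ↦ log (r v) + log ‖v‖)
    (f' := fun v ↦ (r v)⁻¹ • fderiv ℝ r v + ‖v‖⁻¹ • (‖v‖⁻¹ • innerSL ℝ v)) (C := 4 * ε)
    (fun v hv ↦ ?_) (fun v hv ↦ ?_) (left_mem_segment ℝ x y) (right_mem_segment ℝ x y)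
  · simpa [hx, hy] using key
  · have hv0 : v ≠ 0 := norm_pos_iff.1 (by linarith [half_le_norm_of_mem_segment hx hy hxy hv])
    have h1 := (((hr.contDiffAt h (by linarith) hv0).differentiableAt one_ne_zero).hasFDerivAt).log
      (hr.pos hv0).ne'
    have h2 := (hasFDerivAt_norm_of_ne_zero hv0).log (norm_ne_zero_iff.2 hv0)
    exact (h1.add h2).hasFDerivWithinAt
  · have hv1 := half_le_norm_of_mem_segment hx hy hxy hv
    have hv0 : v ≠ 0 := norm_pos_iff.1 (by linarith)
    refine ContinuousLinearMap.opNorm_le_bound _ (by positivity) fun w ↦ ?_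
    refine (hr.abs_logDeriv_le h hε hv0 w).trans ?_
    gcongr
    rw [div_le_iff₀ (by linarith)]
    nlinarith

/-- The logarithm of the radius is Lipschitz on the unit sphere, with constant of order `ε`. -/
theorem IsRadius.abs_log_sub_log_le (hr : K.IsRadius c r) (h : K.IsPerturbedBallAt c ε)
    (hn : 3 ≤ n) (hε : ε ≤ 2⁻¹) {x y : Euc n} (hx : ‖x‖ = 1) (hy : ‖y‖ = 1) :
    |log (r y) - log (r x)| ≤ 8 * ε * ‖y - x‖ := by
  have hε0 : 0 ≤ ε := by
    have hx0 : x ≠ 0 := by rintro rfl; simp at hx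
    exact (norm_nonneg _).trans (hr.norm_normal_sub_le h hx0)
  rcases le_total 0 (inner ℝ x y) with hxy | hxy
  · refine (hr.abs_log_sub_log_le_of_segment h hε hx hy hxy).trans ?_
    gcongr
    norm_num
  · obtain ⟨z, hz, hxz, hyz⟩ := exists_unit_orthogonal hn x y
    have h1 := hr.abs_log_sub_log_le_of_segment h hε hx hz hxz.ge
    have h2 := hr.abs_log_sub_log_le_of_segment h hε hy hz hyz.ge
    have key : ∀ w : Euc n, ‖w‖ = 1 → inner ℝ w z = 0 → ‖z - w‖ ≤ ‖y - x‖ := by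
      intro w hw hwz
      refine le_of_sq_le_sq ?_ (norm_nonneg _)
      rw [norm_sub_sq_real, norm_sub_sq_real, hw, hx, hy, hz, real_inner_comm, hwz,
        real_inner_comm]
      linarith
    have h3 := key x hx hxz
    have h4 := key y hy hyz
    calc |log (r y) - log (r x)| ≤ |log (r z) - log (r x)| + |log (r z) - log (r y)| := by
          have := abs_sub (log (r z) - log (r x)) (log (r z) - log (r y))
          rwa [sub_sub_sub_cancel_left] at this
      _ ≤ 4 * ε * ‖z - x‖ + 4 * ε * ‖z - y‖ := add_le_add h1 h2
      _ ≤ 4 * ε * ‖y - x‖ + 4 * ε * ‖y - x‖ := by gcongr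
      _ = 8 * ε * ‖y - x‖ := by ring

end LogRadius

end SmoothBody

theorem abs_sub_le_mul_abs_log_sub_log {s t m : ℝ} (hs : 0 < s) (ht : 0 < t) (hsm : s ≤ m)
    (htm : t ≤ m) : |s - t| ≤ m * |log s - log t| := by
  wlog hst : s ≤ t generalizing s t
  · rw [abs_sub_comm s, abs_sub_comm (log s)]
    exact this ht hs htm hsm (le_of_not_ge hst)
  have hlog := Real.log_le_log hs hst
  rw [abs_sub_comm, abs_of_nonneg (sub_nonneg.2 hst), abs_sub_comm,
    abs_of_nonneg (sub_nonneg.2 hlog), ← Real.log_div ht.ne' hs.ne']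
  have h1 := Real.one_sub_inv_le_log_of_pos (div_pos ht hs)
  have h2 : 0 ≤ log (t / s) := Real.log_nonneg ((one_le_div hs).2 hst)
  calc t - s = t * (1 - (t / s)⁻¹) := by field_simp
    _ ≤ t * log (t / s) := by gcongr
    _ ≤ m * log (t / s) := by gcongr

theorem mul_norm_sub_le_norm_smul_sub_smul {E : Type*} [NormedAddCommGroup E]
    [InnerProductSpace ℝ E] {x y : E} (hx : ‖x‖ = 1) (hy : ‖y‖ = 1) {R s t : ℝ} (hR : 0 ≤ R)
    (hs : R ≤ s) (ht : R ≤ t) : R * ‖x - y‖ ≤ ‖s • x - t • y‖ := by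
  refine le_of_sq_le_sq ?_ (norm_nonneg _)
  have h1 : ‖s • x - t • y‖ ^ 2 = (s - t) ^ 2 + s * t * ‖x - y‖ ^ 2 := by
    rw [norm_sub_sq_real, norm_sub_sq_real, norm_smul, norm_smul, real_inner_smul_left,
      real_inner_smul_right, hx, hy, mul_one, mul_one, Real.norm_eq_abs, Real.norm_eq_abs,
      sq_abs, sq_abs]
    ring
  rw [h1, mul_pow]
  have h2 : R ^ 2 ≤ s * t := by nlinarith
  nlinarith [sq_nonneg (s - t), sq_nonneg ‖x - y‖]

theorem ne_zero_of_mem_unitSphere {n : ℕ} (ω : sphere (0 : Euc n) 1) : (ω : Euc n) ≠ 0 :=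
  ne_of_mem_sphere ω.2 one_ne_zero

theorem toReal_hausdorffMeasure_unitSphere {n : ℕ} (hn : 1 ≤ n) :
    (μH[(n : ℝ) - 1] (univ : Set (sphere (0 : Euc n) 1))).toReal = sphereArea n := by
  have hd : (0 : ℝ) ≤ (n : ℝ) - 1 := by
    have : (1 : ℝ) ≤ n := by exact_mod_cast hn
    linarith
  rw [sphereArea, ← (isometry_subtype_coe (s := sphere (0 : Euc n) 1)).hausdorffMeasure_image
    (Or.inl hd), image_univ, Subtype.range_coe]

namespace SmoothBody

section RadialMap

variable {n : ℕ} {K : SmoothBody n} {c : Euc n} {ε : ℝ} {r : Euc n → ℝ}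

theorem isClosed_bdry : IsClosed K.bdry :=
  isClosed_eq K.smooth.continuous continuous_const

theorem isCompact_bdry : IsCompact K.bdry :=
  Metric.isCompact_of_isClosed_isBounded isClosed_bdry (K.bounded.subset fun _ hx ↦ hx.le)

theorem continuousOn_meanCurv : ContinuousOn K.meanCurv K.bdry := by
  let T : (Euc n →L[ℝ] Euc n) →ₗ[ℝ] ℝ :=
    LinearMap.trace ℝ (Euc n) ∘ₗ ContinuousLinearMap.coeLM ℝ
  have hT : Continuous T := T.continuous_of_finiteDimensional
  intro x hx
  have h1 : ContinuousAt (fderiv ℝ K.normal) x :=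
    ((contDiffAt_normal hx).fderiv_right (m := 0) (by norm_num)).continuousAt
  exact (hT.continuousAt.comp h1).continuousWithinAt

/-- Radial parametrization of the boundary by the unit sphere. -/
def radialMap (c : Euc n) (r : Euc n → ℝ) (ω : sphere (0 : Euc n) 1) : Euc n :=
  c + r ω • (ω : Euc n)

theorem IsRadius.radialMap_mem (hr : K.IsRadius c r) (ω : sphere (0 : Euc n) 1) :
    radialMap c r ω ∈ K.bdry :=
  hr.mem_bdry (ne_zero_of_mem_unitSphere ω)

theorem IsRadius.range_radialMap (hr : K.IsRadius c r) (h : K.IsPerturbedBallAt c ε)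
    (hε : ε < 1) : range (radialMap c r) = K.bdry := by
  refine Subset.antisymm (range_subset_iff.2 hr.radialMap_mem) fun x hx ↦ ?_
  have hne : x - c ≠ 0 := sub_ne_zero.2 (h.ne_center hε hx)
  have hpos : 0 < ‖x - c‖ := norm_pos_iff.2 hne
  have hx' : c + ‖x - c‖ • ‖x - c‖⁻¹ • (x - c) = x := by
    rw [smul_inv_smul₀ hpos.ne', add_sub_cancel]
  have hu : ‖‖x - c‖⁻¹ • (x - c)‖ = 1 := norm_smul_inv_norm hne
  refine ⟨⟨‖x - c‖⁻¹ • (x - c), mem_sphere_zero_iff_norm.2 hu⟩, ?_⟩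
  have := ((hr (‖x - c‖⁻¹ • (x - c)) (smul_ne_zero (inv_ne_zero hpos.ne') hne)).2 _ hpos).1
    (by rw [hx']; exact hx)
  simp only [radialMap, ← this, hx']

theorem IsRadius.continuous_radius (hr : K.IsRadius c r) (h : K.IsPerturbedBallAt c ε)
    (hε : ε < 1) : Continuous fun ω : sphere (0 : Euc n) 1 ↦ r ω :=
  continuous_iff_continuousAt.2 fun ω ↦
    ((hr.contDiffAt h hε (ne_zero_of_mem_unitSphere ω)).continuousAt).comp
      continuous_subtype_val.continuousAt

theorem IsRadius.continuous_radialMap (hr : K.IsRadius c r) (h : K.IsPerturbedBallAt c ε)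
    (hε : ε < 1) : Continuous (radialMap c r) :=
  continuous_const.add ((hr.continuous_radius h hε).smul continuous_subtype_val)

/-- The radius is pinched between its minimum and a multiple of it close to one. -/
theorem IsRadius.exists_pinching (hr : K.IsRadius c r) (h : K.IsPerturbedBallAt c ε)
    (hn : 3 ≤ n) (hε : ε ≤ 2⁻¹) :
    ∃ R : ℝ, 0 < R ∧ ∀ ω : sphere (0 : Euc n) 1, R ≤ r ω ∧ r ω ≤ R * exp (16 * ε) := by
  have : Nonempty (Fin n) := ⟨⟨0, by lia⟩⟩
  have : Nonempty (sphere (0 : Euc n) 1) := (NormedSpace.sphere_nonempty.2 zero_le_one).to_subtype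
  obtain ⟨ω₀, -, h₀⟩ := isCompact_univ.exists_isMinOn univ_nonempty
    (hr.continuous_radius h (by linarith)).continuousOn
  have hpos := hr.pos (ne_zero_of_mem_unitSphere ω₀)
  refine ⟨r ω₀, hpos, fun ω ↦ ⟨h₀ (mem_univ ω), ?_⟩⟩
  have hω := mem_sphere_zero_iff_norm.1 ω.2
  have hω₀ := mem_sphere_zero_iff_norm.1 ω₀.2
  have h1 := (le_abs_self _).trans (hr.abs_log_sub_log_le h hn hε hω₀ hω)
  have hε0 : 0 ≤ ε := (norm_nonneg _).trans (hr.norm_normal_sub_le h (ne_zero_of_mem_unitSphere ω))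
  have h2 : ‖(ω : Euc n) - ω₀‖ ≤ 2 := by
    have := norm_sub_le (ω : Euc n) ω₀
    linarith
  have h3 : log (r ω) ≤ log (r ω₀) + 16 * ε := by nlinarith
  calc r ω = exp (log (r ω)) := (exp_log (hr.pos (ne_zero_of_mem_unitSphere ω))).symm
    _ ≤ exp (log (r ω₀) + 16 * ε) := exp_le_exp.2 h3
    _ = r ω₀ * exp (16 * ε) := by rw [exp_add, exp_log hpos]

theorem IsRadius.antilipschitzWith_radialMap {R : ℝ} (hR : 0 < R)
    (hRr : ∀ ω : sphere (0 : Euc n) 1, R ≤ r ω) :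
    AntilipschitzWith (R⁻¹).toNNReal (radialMap c r) := by
  refine AntilipschitzWith.of_le_mul_dist fun x y ↦ ?_
  have h1 := mul_norm_sub_le_norm_smul_sub_smul (mem_sphere_zero_iff_norm.1 x.2)
    (mem_sphere_zero_iff_norm.1 y.2) hR.le (hRr x) (hRr y)
  rw [Real.coe_toNNReal _ (inv_pos.2 hR).le, Subtype.dist_eq, dist_eq_norm, dist_eq_norm,
    le_inv_mul_iff₀ hR, radialMap, radialMap, add_sub_add_left_eq_sub]
  exact h1

theorem IsRadius.lipschitzWith_radialMap (hr : K.IsRadius c r) (h : K.IsPerturbedBallAt c ε)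
    (hn : 3 ≤ n) (hε : ε ≤ 2⁻¹) {m : ℝ} (hm : 0 ≤ m)
    (hrm : ∀ ω : sphere (0 : Euc n) 1, r ω ≤ m) :
    LipschitzWith (m * (1 + 8 * ε)).toNNReal (radialMap c r) := by
  refine LipschitzWith.of_dist_le_mul fun x y ↦ ?_
  have hx := mem_sphere_zero_iff_norm.1 x.2
  have hy := mem_sphere_zero_iff_norm.1 y.2
  have hx0 := ne_zero_of_mem_unitSphere x
  have hy0 := ne_zero_of_mem_unitSphere y
  have hε0 : 0 ≤ ε := (norm_nonneg _).trans (hr.norm_normal_sub_le h hx0)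
  have h1 := abs_sub_le_mul_abs_log_sub_log (hr.pos hx0) (hr.pos hy0) (hrm x) (hrm y)
  have h2 := hr.abs_log_sub_log_le h hn hε hy hx
  have h3 : r x • (x : Euc n) - r y • (y : Euc n) =
      r x • ((x : Euc n) - y) + (r x - r y) • (y : Euc n) := by
    rw [smul_sub, sub_smul]
    abel
  rw [Real.coe_toNNReal _ (by positivity), Subtype.dist_eq, dist_eq_norm, dist_eq_norm,
    radialMap, radialMap, add_sub_add_left_eq_sub, h3]
  calc _ ≤ ‖r x • ((x : Euc n) - y)‖ + ‖(r x - r y) • (y : Euc n)‖ := norm_add_le _ _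
    _ = r x * ‖(x : Euc n) - y‖ + |r x - r y| := by
      rw [norm_smul, norm_smul, hy, mul_one, Real.norm_of_nonneg (hr.pos hx0).le,
        Real.norm_eq_abs]
    _ ≤ m * ‖(x : Euc n) - y‖ + m * (8 * ε * ‖(x : Euc n) - y‖) := by
      gcongr
      · exact hrm x
      · exact h1.trans (by gcongr)
    _ = _ := by ring

end RadialMap

end SmoothBody

namespace SmoothBody

section Comparison

variable {n : ℕ} {K : SmoothBody n} {c : Euc n} {ε : ℝ} {r : Euc n → ℝ}

theorem IsRadius.hausdorffMeasure_bdry_le (hr : K.IsRadius c r) (h : K.IsPerturbedBallAt c ε)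
    (hn : 3 ≤ n) (hε : ε ≤ 2⁻¹) {m : ℝ} (hm : 0 ≤ m)
    (hrm : ∀ ω : sphere (0 : Euc n) 1, r ω ≤ m) :
    μH[(n : ℝ) - 1] K.bdry ≤ ((m * (1 + 8 * ε)).toNNReal : ℝ≥0∞) ^ ((n : ℝ) - 1) *
      μH[(n : ℝ) - 1] (univ : Set (sphere (0 : Euc n) 1)) := by
  have hd : (0 : ℝ) ≤ (n : ℝ) - 1 := by
    have : (3 : ℝ) ≤ n := by exact_mod_cast hn
    linarith
  rw [← hr.range_radialMap h (by linarith), ← image_univ]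
  exact (hr.lipschitzWith_radialMap h hn hε hm hrm).hausdorffMeasure_image_le hd univ

theorem IsRadius.map_radialMap_le (hr : K.IsRadius c r) (h : K.IsPerturbedBallAt c ε)
    (hn : 3 ≤ n) (hε : ε < 1) {R : ℝ} (hR : 0 < R)
    (hRr : ∀ ω : sphere (0 : Euc n) 1, R ≤ r ω) :
    (μH[(n : ℝ) - 1] : Measure (sphere (0 : Euc n) 1)).map (radialMap c r) ≤
      (((R⁻¹).toNNReal : ℝ≥0∞) ^ ((n : ℝ) - 1)) • (μH[(n : ℝ) - 1]).restrict K.bdry := by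
  have hd : (0 : ℝ) ≤ (n : ℝ) - 1 := by
    have : (3 : ℝ) ≤ n := by exact_mod_cast hn
    linarith
  refine Measure.le_iff.2 fun s hs ↦ ?_
  rw [Measure.map_apply (hr.continuous_radialMap h hε).measurable hs, Measure.smul_apply,
    Measure.restrict_apply hs, smul_eq_mul]
  have hpre : radialMap c r ⁻¹' s = radialMap c r ⁻¹' (s ∩ K.bdry) := by
    ext ω
    simp [hr.radialMap_mem ω]
  rw [hpre]
  exact (antilipschitzWith_radialMap hR hRr).hausdorffMeasure_preimage_le hd _

theorem IsRadius.perim_le (hr : K.IsRadius c r) (h : K.IsPerturbedBallAt c ε)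
    (hn : 3 ≤ n) (hε0 : 0 ≤ ε) (hε : ε ≤ 2⁻¹) {m : ℝ} (hm : 0 ≤ m)
    (hrm : ∀ ω : sphere (0 : Euc n) 1, r ω ≤ m)
    [IsFiniteMeasure (μH[(n : ℝ) - 1] : Measure (sphere (0 : Euc n) 1))] :
    K.perim ≤ (m * (1 + 8 * ε)) ^ ((n : ℝ) - 1) * sphereArea n := by
  have hd : (0 : ℝ) ≤ (n : ℝ) - 1 := by
    have : (3 : ℝ) ≤ n := by exact_mod_cast hn
    linarith
  have h1 := ENNReal.toReal_mono (ENNReal.mul_ne_top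
    (ENNReal.rpow_ne_top_of_nonneg hd ENNReal.coe_ne_top) (measure_ne_top _ _))
    (hr.hausdorffMeasure_bdry_le h hn hε hm hrm)
  rwa [ENNReal.toReal_mul, ← ENNReal.toReal_rpow, ENNReal.coe_toReal,
    Real.coe_toNNReal _ (by positivity), toReal_hausdorffMeasure_unitSphere (by lia)] at h1

theorem IsRadius.hausdorffMeasure_bdry_ne_top (hr : K.IsRadius c r)
    (h : K.IsPerturbedBallAt c ε) (hn : 3 ≤ n) (hε : ε ≤ 2⁻¹) {m : ℝ} (hm : 0 ≤ m)
    (hrm : ∀ ω : sphere (0 : Euc n) 1, r ω ≤ m)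
    [IsFiniteMeasure (μH[(n : ℝ) - 1] : Measure (sphere (0 : Euc n) 1))] :
    μH[(n : ℝ) - 1] K.bdry ≠ ∞ := by
  have hd : (0 : ℝ) ≤ (n : ℝ) - 1 := by
    have : (3 : ℝ) ≤ n := by exact_mod_cast hn
    linarith
  exact ne_top_of_le_ne_top (ENNReal.mul_ne_top
    (ENNReal.rpow_ne_top_of_nonneg hd ENNReal.coe_ne_top) (measure_ne_top _ _))
    (hr.hausdorffMeasure_bdry_le h hn hε hm hrm)

theorem IsRadius.sphereArea_le (hr : K.IsRadius c r) (h : K.IsPerturbedBallAt c ε)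
    (hn : 3 ≤ n) (hε : ε < 1) {R : ℝ} (hR : 0 < R)
    (hRr : ∀ ω : sphere (0 : Euc n) 1, R ≤ r ω) (hfin : μH[(n : ℝ) - 1] K.bdry ≠ ∞) :
    sphereArea n ≤ R⁻¹ ^ ((n : ℝ) - 1) * K.perim := by
  have hd : (0 : ℝ) ≤ (n : ℝ) - 1 := by
    have : (3 : ℝ) ≤ n := by exact_mod_cast hn
    linarith
  have h1 := hr.map_radialMap_le h hn hε hR hRr univ
  rw [Measure.map_apply (hr.continuous_radialMap h hε).measurable MeasurableSet.univ,
    Measure.smul_apply, Measure.restrict_apply_univ, smul_eq_mul, preimage_univ] at h1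
  have h2 := ENNReal.toReal_mono (ENNReal.mul_ne_top
    (ENNReal.rpow_ne_top_of_nonneg hd ENNReal.coe_ne_top) hfin) h1
  rwa [ENNReal.toReal_mul, ← ENNReal.toReal_rpow, ENNReal.coe_toReal,
    Real.coe_toNNReal _ (by positivity), toReal_hausdorffMeasure_unitSphere (by lia)] at h2

theorem IsRadius.integral_comp_radialMap_le (hr : K.IsRadius c r) (h : K.IsPerturbedBallAt c ε)
    (hn : 3 ≤ n) (hε : ε < 1) {R : ℝ} (hR : 0 < R)
    (hRr : ∀ ω : sphere (0 : Euc n) 1, R ≤ r ω) (hfin : μH[(n : ℝ) - 1] K.bdry ≠ ∞)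
    {G : Euc n → ℝ} (hG : ContinuousOn G K.bdry) (hG0 : ∀ x, 0 ≤ G x) :
    ∫ ω : sphere (0 : Euc n) 1, G (radialMap c r ω) ∂μH[(n : ℝ) - 1] ≤
      R⁻¹ ^ ((n : ℝ) - 1) * ∫ x in K.bdry, G x ∂μH[(n : ℝ) - 1] := by
  have hd : (0 : ℝ) ≤ (n : ℝ) - 1 := by
    have : (3 : ℝ) ≤ n := by exact_mod_cast hn
    linarith
  have hle := hr.map_radialMap_le h hn hε hR hRr
  have hmeas : AEStronglyMeasurable G ((μH[(n : ℝ) - 1]).restrict K.bdry) :=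
    hG.aestronglyMeasurable isClosed_bdry.measurableSet
  obtain ⟨C, hC⟩ := isCompact_bdry.exists_bound_of_continuousOn hG
  have hint : Integrable G ((μH[(n : ℝ) - 1]).restrict K.bdry) := by
    have : IsFiniteMeasure ((μH[(n : ℝ) - 1]).restrict K.bdry) :=
      ⟨by rw [Measure.restrict_apply_univ]; exact hfin.lt_top⟩
    refine Integrable.of_bound hmeas C ?_
    filter_upwards [ae_restrict_mem isClosed_bdry.measurableSet] with x hx using hC x hx
  have hint' := hint.smul_measure (c := ((R⁻¹).toNNReal : ℝ≥0∞) ^ ((n : ℝ) - 1))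
    (ENNReal.rpow_ne_top_of_nonneg hd ENNReal.coe_ne_top)
  have h1 := integral_mono_measure hle (Filter.Eventually.of_forall hG0) hint'
  rw [integral_map (hr.continuous_radialMap h hε).aemeasurable
    (hint'.aestronglyMeasurable.mono_measure hle), integral_smul_measure, smul_eq_mul,
    ← ENNReal.toReal_rpow, ENNReal.coe_toReal, Real.coe_toNNReal _ (by positivity)] at h1
  exact h1

/-- A lower bound for the total positive mean curvature of a perturbed ball. -/
theorem IsRadius.le_integral_meanCurv (hr : K.IsRadius c r) (h : K.IsPerturbedBallAt c ε)
    (hn : 3 ≤ n) (hε : ε ≤ 2⁻¹) {R m : ℝ} (hR : 0 < R)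
    (hRr : ∀ ω : sphere (0 : Euc n) 1, R ≤ r ω) (hm : 0 ≤ m)
    (hrm : ∀ ω : sphere (0 : Euc n) 1, r ω ≤ m)
    [IsFiniteMeasure (μH[(n : ℝ) - 1] : Measure (sphere (0 : Euc n) 1))] :
    ((n : ℝ) - 1) * (1 - ε) * sphereArea n ≤ m * (R⁻¹ ^ ((n : ℝ) - 1) *
      ∫ x in K.bdry, max (K.meanCurv x) 0 ∂μH[(n : ℝ) - 1]) := by
  have hε1 : ε < 1 := by linarith
  have hd : (0 : ℝ) ≤ (n : ℝ) - 1 := by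
    have : (3 : ℝ) ≤ n := by exact_mod_cast hn
    linarith
  have hint : ∀ {f : sphere (0 : Euc n) 1 → ℝ}, Continuous f → Integrable f μH[(n : ℝ) - 1] :=
    fun hf ↦ hf.integrable_of_hasCompactSupport (HasCompactSupport.of_compactSpace _)
  have hψ := hr.continuous_radialMap h hε1
  have hH : Continuous fun ω : sphere (0 : Euc n) 1 ↦ K.meanCurv (radialMap c r ω) :=
    continuousOn_meanCurv.comp_continuous hψ hr.radialMap_mem
  have hνc : Continuous fun ω : sphere (0 : Euc n) 1 ↦ K.normal (radialMap c r ω) :=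
    ContinuousOn.comp_continuous (g := K.normal) (s := K.bdry)
      (fun x hx ↦ (contDiffAt_normal hx).continuousAt.continuousWithinAt) hψ hr.radialMap_mem
  have hdiv := integral_hausdorffMeasure_sphere_divg (M := fun x ↦ K.normal (c + r x • x))
    (by lia) (fun x hx ↦ hr.contDiffAt_normal_comp h hε1 hx)
    (fun t ht x ↦ by rw [hr.smul_apply_smul ht])
  have h1 : (1 - ε) * sphereArea n ≤
      ∫ ω : sphere (0 : Euc n) 1, inner ℝ (K.normal (c + r ω • (ω : Euc n))) (ω : Euc n)
        ∂μH[(n : ℝ) - 1] := by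
    have : ∫ _ : sphere (0 : Euc n) 1, (1 - ε) ∂μH[(n : ℝ) - 1] = (1 - ε) * sphereArea n := by
      rw [integral_const, smul_eq_mul, mul_comm, Measure.real,
        toReal_hausdorffMeasure_unitSphere (by lia)]
    rw [← this]
    refine integral_mono (integrable_const _) (hint (hνc.inner continuous_subtype_val)) fun ω ↦ ?_
    have hω := ne_zero_of_mem_unitSphere ω
    have h2 := h.inner_normal_ge hε1 (hr.mem_bdry hω)
    have hp := hr.pos hω
    rw [add_sub_cancel_left, norm_smul, mem_sphere_zero_iff_norm.1 ω.2, mul_one,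
      Real.norm_of_nonneg hp.le, real_inner_smul_right, mul_comm] at h2
    exact le_of_mul_le_mul_left h2 hp
  have h3 : ∫ ω : sphere (0 : Euc n) 1, divg (fun x ↦ K.normal (c + r x • x)) ω ∂μH[(n : ℝ) - 1] ≤
      m * ∫ ω : sphere (0 : Euc n) 1, max (K.meanCurv (radialMap c r ω)) 0 ∂μH[(n : ℝ) - 1] := by
    rw [← integral_const_mul]
    have h4 : ∀ ω : sphere (0 : Euc n) 1, divg (fun x ↦ K.normal (c + r x • x)) ω =
        r ω * K.meanCurv (radialMap c r ω) :=
      fun ω ↦ hr.divg_normal h hε1 (ne_zero_of_mem_unitSphere ω)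
    simp only [h4]
    refine integral_mono (hint ((hr.continuous_radius h hε1).mul hH))
      (hint (continuous_const.mul (hH.max continuous_const))) fun ω ↦ ?_
    have hp := hr.pos (ne_zero_of_mem_unitSphere ω)
    exact (mul_le_mul_of_nonneg_left (le_max_left _ 0) hp.le).trans
      (mul_le_mul_of_nonneg_right (hrm ω) (le_max_right _ _))
  have h5 := hr.integral_comp_radialMap_le h hn hε1 hR hRr
    (hr.hausdorffMeasure_bdry_ne_top h hn hε hm hrm)
    (ContinuousOn.sup continuousOn_meanCurv continuousOn_const)
    (fun x ↦ le_max_right (K.meanCurv x) 0)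
  calc ((n : ℝ) - 1) * (1 - ε) * sphereArea n = ((n : ℝ) - 1) * ((1 - ε) * sphereArea n) := by ring
    _ ≤ _ := mul_le_mul_of_nonneg_left h1 hd
    _ = _ := hdiv.symm
    _ ≤ _ := h3
    _ ≤ _ := mul_le_mul_of_nonneg_left h5 hm

end Comparison

end SmoothBody

/-- For every `n ≥ 3` and every `δ > 0` there exists `ε₄ = ε₄(n, δ) > 0`
such that for every `K ⊆ ℝⁿ` which is a `C¹` `ε₄`-perturbation of a ball,
`(∫_{∂K} H⁺ dH^{n-1})^{1/(n-2)} / Per(K)^{1/(n-1)}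
  ≥ ((n-1)·H^{n-1}(S^{n-1}))^{1/(n-2)} / Per(B₁)^{1/(n-1)} − δ`. -/
theorem minkowski_almost_sharp (n : ℕ) (hn : 3 ≤ n) (δ : ℝ) (hδ : 0 < δ) :
    ∃ ε₄ : ℝ, 0 < ε₄ ∧ ∀ K : SmoothBody n, K.IsPerturbedBall ε₄ →
      (∫ x in K.bdry, max (K.meanCurv x) 0 ∂μH[(n : ℝ) - 1]) ^ (((n : ℝ) - 2)⁻¹)
          / K.perim ^ (((n : ℝ) - 1)⁻¹)
        ≥ (((n : ℝ) - 1) * sphereArea n) ^ (((n : ℝ) - 2)⁻¹)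
          / (sphereArea n) ^ (((n : ℝ) - 1)⁻¹) - δ := by
  have hn' : (3 : ℝ) ≤ n := by exact_mod_cast hn
  have hA0 : 0 ≤ sphereArea n := ENNReal.toReal_nonneg
  have hI0 : ∀ K : SmoothBody n,
      0 ≤ ∫ x in K.bdry, max (K.meanCurv x) 0 ∂μH[(n : ℝ) - 1] :=
    fun K ↦ integral_nonneg fun x ↦ le_max_right _ _
  rcases hA0.eq_or_lt with hA | hA
  · refine ⟨1, one_pos, fun K _ ↦ ?_⟩
    have h1 : 0 ≤ (∫ x in K.bdry, max (K.meanCurv x) 0 ∂μH[(n : ℝ) - 1]) ^ (((n : ℝ) - 2)⁻¹)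
        / K.perim ^ (((n : ℝ) - 1)⁻¹) :=
      div_nonneg (rpow_nonneg (hI0 K) _) (rpow_nonneg ENNReal.toReal_nonneg _)
    have h2 : ((n : ℝ) - 1)⁻¹ ≠ 0 := inv_ne_zero (by linarith)
    rw [← hA, zero_rpow h2, div_zero]
    linarith
  have hfin : IsFiniteMeasure (μH[(n : ℝ) - 1] : Measure (sphere (0 : Euc n) 1)) := by
    refine ⟨lt_top_iff_ne_top.2 fun htop ↦ hA.ne' ?_⟩
    rw [← toReal_hausdorffMeasure_unitSphere (by lia), htop, ENNReal.toReal_top]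
  set Q := (((n : ℝ) - 1) * sphereArea n) ^ (((n : ℝ) - 2)⁻¹)
    / (sphereArea n) ^ (((n : ℝ) - 1)⁻¹) with hQ
  obtain ⟨ε, hε0, hε, hΘ⟩ : ∃ ε : ℝ, 0 < ε ∧ ε < 2⁻¹ ∧
      Q - δ < ((1 - ε) / exp (16 * ε)) ^ (((n : ℝ) - 2)⁻¹) / (exp (16 * ε) * (1 + 8 * ε)) * Q := by
    have hcont : ContinuousAt (fun ε : ℝ ↦ ((1 - ε) / exp (16 * ε)) ^ (((n : ℝ) - 2)⁻¹)
        / (exp (16 * ε) * (1 + 8 * ε)) * Q) 0 := by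
      refine ((ContinuousAt.div ?_ (by fun_prop) (by simp)).mul continuousAt_const)
      exact ContinuousAt.rpow_const (ContinuousAt.div (by fun_prop) (by fun_prop) (by simp))
        (Or.inl (by simp))
    have hev := hcont.eventually_const_lt (show Q - δ < _ by simpa using hδ)
    have hev' := (hev.and (eventually_lt_nhds (show (0 : ℝ) < 2⁻¹ by norm_num))).filter_mono
      (nhdsWithin_le_nhds (s := Ioi 0))
    obtain ⟨ε, ⟨h1, h2⟩, h3⟩ := (hev'.and self_mem_nhdsWithin).exists
    exact ⟨ε, h3, h2, h1⟩
  refine ⟨ε, hε0, fun K hK ↦ hΘ.le.trans ?_⟩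
  obtain ⟨c, h⟩ := hK
  replace h : K.IsPerturbedBallAt c ε := h
  obtain ⟨r, hr⟩ := h.exists_isRadius (by linarith)
  obtain ⟨R, hR, hpinch⟩ := hr.exists_pinching h hn hε.le
  set E := exp (16 * ε) with hE
  have hEpos : 0 < E := exp_pos _
  have hm : 0 ≤ R * E := by positivity
  have hI := hr.le_integral_meanCurv h hn hε.le hR (fun ω ↦ (hpinch ω).1) hm
    (fun ω ↦ (hpinch ω).2)
  have hP := hr.perim_le h hn hε0.le hε.le hm (fun ω ↦ (hpinch ω).2)
  have hP' := hr.sphereArea_le h hn (by linarith) hR (fun ω ↦ (hpinch ω).1)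
    (hr.hausdorffMeasure_bdry_ne_top h hn hε.le hm (fun ω ↦ (hpinch ω).2))
  have hPpos : 0 < K.perim :=
    pos_of_mul_pos_right (hA.trans_le hP') (rpow_nonneg (inv_nonneg.2 hR.le) _)
  set I := ∫ x in K.bdry, max (K.meanCurv x) 0 ∂μH[(n : ℝ) - 1]
  have hn2 : (n : ℝ) - 2 ≠ 0 := by linarith
  have hn1 : (n : ℝ) - 1 ≠ 0 := by linarith
  have hI1 : (1 - ε) / E * (((n : ℝ) - 1) * sphereArea n) * R ^ ((n : ℝ) - 2) ≤ I := by
    have h1 : R ^ ((n : ℝ) - 1) = R ^ ((n : ℝ) - 2) * R := by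
      rw [← rpow_add_one hR.ne']
      ring_nf
    rw [inv_rpow hR.le, h1] at hI
    have h2 : 0 < R ^ ((n : ℝ) - 2) := rpow_pos_of_pos hR _
    rw [div_mul_eq_mul_div, div_mul_eq_mul_div, div_le_iff₀ hEpos]
    calc _ = ((n : ℝ) - 1) * (1 - ε) * sphereArea n * R ^ ((n : ℝ) - 2) := by ring
      _ ≤ R * E * ((R ^ ((n : ℝ) - 2) * R)⁻¹ * I) * R ^ ((n : ℝ) - 2) := by gcongr
      _ = I * E := by field_simp
  have hε1 : 0 ≤ (1 - ε) / E := div_nonneg (by linarith) hEpos.le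
  have hnA : 0 ≤ ((n : ℝ) - 1) * sphereArea n := mul_nonneg (by linarith) hA0
  have hI2 : ((1 - ε) / E) ^ (((n : ℝ) - 2)⁻¹) *
      (((n : ℝ) - 1) * sphereArea n) ^ (((n : ℝ) - 2)⁻¹) * R ≤ I ^ (((n : ℝ) - 2)⁻¹) := by
    calc _ = ((1 - ε) / E * (((n : ℝ) - 1) * sphereArea n) * R ^ ((n : ℝ) - 2)) ^
          (((n : ℝ) - 2)⁻¹) := by
          rw [mul_rpow (mul_nonneg hε1 hnA) (rpow_nonneg hR.le _), rpow_rpow_inv hR.le hn2,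
            mul_rpow hε1 hnA]
      _ ≤ _ := rpow_le_rpow (mul_nonneg (mul_nonneg hε1 hnA) (rpow_nonneg hR.le _)) hI1
          (inv_nonneg.2 (by linarith))
  have hP1 : K.perim ^ (((n : ℝ) - 1)⁻¹) ≤
      R * E * (1 + 8 * ε) * sphereArea n ^ (((n : ℝ) - 1)⁻¹) := by
    calc _ ≤ ((R * E * (1 + 8 * ε)) ^ ((n : ℝ) - 1) * sphereArea n) ^ (((n : ℝ) - 1)⁻¹) :=
          rpow_le_rpow hPpos.le hP (inv_nonneg.2 (by linarith))
      _ = _ := by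
          rw [mul_rpow (by positivity) hA0, rpow_rpow_inv (by positivity) hn1]
  have hPp : 0 < K.perim ^ (((n : ℝ) - 1)⁻¹) := rpow_pos_of_pos hPpos _
  have hAp : 0 < sphereArea n ^ (((n : ℝ) - 1)⁻¹) := rpow_pos_of_pos hA _
  calc _ = (((1 - ε) / E) ^ (((n : ℝ) - 2)⁻¹) *
        (((n : ℝ) - 1) * sphereArea n) ^ (((n : ℝ) - 2)⁻¹) * R) /
        (R * E * (1 + 8 * ε) * sphereArea n ^ (((n : ℝ) - 1)⁻¹)) := by
        rw [hQ]
        field_simp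
    _ ≤ _ := div_le_div₀ (rpow_nonneg (hI0 K) _) hI2 hPp hP1
end
end

section
/- For every integer n ≥ 3 and every δ > 0 there exists ε₀ > 0 such that the following holds. Let K ⊆ ℝⁿ be a bounded star-shaped domain with smooth boundary, let u : S^{n-1} → (−1, ∞) be the smooth function with (1+u(x))x ∈ ∂K for every x ∈ S^{n-1}, and assume ‖u‖_{C¹(S^{n-1})} < ε₀. Then | ∫_{∂K} H dH^{n-1} − (n−1)H^{n-1}(S^{n-1}) − (n−1)(n−2)∫_{S^{n-1}} u − ((n−1)(n−2)(n−3)/2)∫_{S^{n-1}} u² − (n−2)∫_{S^{n-1}} |∇u|² − ∫_{S^{n-1}} (1+u)^{n-3} ∇²u[∇u, ∇u] / ((1+u)² + |∇u|²) | ≤ δ ∫_{S^{n-1}} (u² + |∇u|²). -/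
open MeasureTheory Metric Set Real
open scoped ENNReal RealInnerProductSpace

noncomputable section

/-- Laplacian (trace of the Hessian). For a `0`-homogeneous function this coincides on the
unit sphere with the Laplace–Beltrami operator of the sphere. -/
def lapl {n : ℕ} (u : Euc n → ℝ) (x : Euc n) : ℝ := divg (gradient u) x

/-- The Hessian of `u` as a bilinear form: `hessBil u x X Y = D²u(x)[X, Y]`. For a
`0`-homogeneous `u` and `X, Y` tangent to the unit sphere at `x`, this coincides with the
covariant Hessian of `u` on the sphere. -/
def hessBil {n : ℕ} (u : Euc n → ℝ) (x X Y : Euc n) : ℝ :=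
  ⟪fderiv ℝ (gradient u) x X, Y⟫

/-- A bounded star-shaped domain with smooth boundary in `ℝⁿ`, encoded by its radial
profile `u : S^{n-1} → (-1, ∞)` (so that `(1 + u(x))·x ∈ ∂K` for `x ∈ S^{n-1}`), extended
to `ℝⁿ \ {0}` as a `0`-homogeneous function. -/
structure StarBody (n : ℕ) where
  u : Euc n → ℝ
  smooth : ContDiffOn ℝ (⊤ : ℕ∞) u {x : Euc n | x ≠ 0}
  homog : ∀ x : Euc n, x ≠ 0 → ∀ t : ℝ, 0 < t → u (t • x) = u x
  gtNegOne : ∀ x : Euc n, -1 < u x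

namespace StarBody

variable {n : ℕ} (K : StarBody n)

/-- The map `T(x) = (1 + u(x))·x` sending the unit sphere onto `∂K`. -/
def T (x : Euc n) : Euc n := (1 + K.u x) • x

/-- The star-shaped domain `K = {r·x : x ∈ S^{n-1}, 0 ≤ r < 1 + u(x)}`. -/
def body : Set (Euc n) := {0} ∪ {y : Euc n | y ≠ 0 ∧ ‖y‖ < 1 + K.u y}

/-- The boundary `∂K = T(S^{n-1})`. -/
def bdry : Set (Euc n) := {y : Euc n | y ≠ 0 ∧ ‖y‖ = 1 + K.u y}

/-- A defining function for `K`: `K = {Fdef < 0}`, `∂K = {Fdef = 0}` (away from `0`). -/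
def Fdef (y : Euc n) : ℝ := ‖y‖ - (1 + K.u y)

/-- The outer unit normal to `∂K`, extended near `∂K` as the normalized gradient of the
defining function. -/
def normal (y : Euc n) : Euc n := ‖gradient K.Fdef y‖⁻¹ • gradient K.Fdef y

/-- The mean curvature of `∂K` (trace of the second fundamental form with respect to the
outer unit normal), computed as the divergence of the unit normal field. -/
def meanCurv (y : Euc n) : ℝ := divg K.normal y

/-- The vector field `v = ∇u/(1 + u)` (the gradient being the gradient on the sphere). -/
def v (x : Euc n) : Euc n := (1 + K.u x)⁻¹ • gradient K.u x

end StarBody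

theorem hausdorffMeasure_image_le_of_dist_le {α X Y : Type*} [MetricSpace X] [MeasurableSpace X]
    [BorelSpace X] [MetricSpace Y] [MeasurableSpace Y] [BorelSpace Y] {f : α → X} {g : α → Y}
    {A : Set α} {C : NNReal} {d : ℝ} (hd : 0 ≤ d)
    (h : ∀ a ∈ A, ∀ b ∈ A, dist (f a) (f b) ≤ C * dist (g a) (g b)) :
    μH[d] (f '' A) ≤ (C : ℝ≥0∞) ^ d * μH[d] (g '' A) := by
  rcases A.eq_empty_or_nonempty with rfl | ⟨a₀, _⟩
  · simp
  have : Nonempty α := ⟨a₀⟩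
  have hinv : ∀ a ∈ A, f (Function.invFunOn g A (g a)) = f a := by
    intro a ha
    have h1 := Function.invFunOn_mem (f := g) (s := A) ⟨a, ha, rfl⟩
    have h2 := Function.invFunOn_eq (f := g) (s := A) ⟨a, ha, rfl⟩
    have h3 := h _ h1 a ha
    rw [h2, dist_self, mul_zero] at h3
    exact dist_le_zero.1 h3
  have himage : (fun y => f (Function.invFunOn g A y)) '' (g '' A) = f '' A := by
    rw [image_image]
    exact image_congr hinv
  have hlip : LipschitzOnWith C (fun y => f (Function.invFunOn g A y)) (g '' A) := by
    apply LipschitzOnWith.of_dist_le_mul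
    rintro _ ⟨a, ha, rfl⟩ _ ⟨b, hb, rfl⟩
    simp only [hinv a ha, hinv b hb]
    exact h a ha b hb
  simpa only [himage] using hlip.hausdorffMeasure_image_le hd

theorem measure_le_of_locally_le {X : Type*} [TopologicalSpace X] [SecondCountableTopology X]
    [MeasurableSpace X] [OpensMeasurableSpace X] {μ ν : Measure X} {S A : Set X}
    (h : ∀ x ∈ S, ∃ U : Set X, IsOpen U ∧ x ∈ U ∧
      ∀ B : Set X, B ⊆ U ∩ S → MeasurableSet B → μ B ≤ ν B)
    (hA : A ⊆ S) (hAm : MeasurableSet A) : μ A ≤ ν A := by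
  choose! U hUo hUx hU using h
  obtain ⟨t, htS, htc, hcov⟩ := TopologicalSpace.countable_cover_nhdsWithin
    (f := U) (s := S) fun x hx => mem_nhdsWithin_of_mem_nhds ((hUo x hx).mem_nhds (hUx x hx))
  rcases t.eq_empty_or_nonempty with rfl | hne
  · have : A = ∅ := by
      apply subset_empty_iff.1 (hA.trans _)
      simpa using hcov
    simp [this]
  obtain ⟨e, rfl⟩ := htc.exists_eq_range hne
  have heS : ∀ i, e i ∈ S := fun i => htS ⟨i, rfl⟩
  have hAeq : A = ⋃ i, A ∩ disjointed (fun i => U (e i)) i := by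
    rw [← inter_iUnion, iUnion_disjointed]
    refine (inter_eq_left.2 ((hA.trans hcov).trans ?_)).symm
    simp
  have hm : ∀ i, MeasurableSet (A ∩ disjointed (fun i => U (e i)) i) := fun i =>
    hAm.inter (MeasurableSet.disjointed (fun i => (hUo _ (heS i)).measurableSet) i)
  have hdisj : Pairwise (Function.onFun Disjoint fun i => A ∩ disjointed (fun i => U (e i)) i) :=
    fun i j hij => (disjoint_disjointed _ hij).mono inter_subset_right inter_subset_right
  rw [hAeq, measure_iUnion hdisj hm, measure_iUnion hdisj hm]
  refine ENNReal.tsum_le_tsum fun i => hU (e i) (heS i) _ ?_ (hm i)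
  exact fun x hx => ⟨disjointed_subset (fun i => U (e i)) i hx.2, hA hx.1⟩

/-- Near a point `x₀` of the unit sphere, a strictly differentiable map `T` is metrically almost
indistinguishable from the orthogonal projection to the tangent space followed by a linear map
having the same norm as the derivative of `T`. -/
theorem exists_open_norm_sub_comparison {E : Type*} [NormedAddCommGroup E] [InnerProductSpace ℝ E]
    [CompleteSpace E]
    {T : E → E} {T' : E →L[ℝ] E} {x₀ : E} (hx₀ : ‖x₀‖ = 1) (hT : HasStrictFDerivAt T T' x₀)
    {S : (ℝ ∙ x₀)ᗮ →ₗ[ℝ] (ℝ ∙ x₀)ᗮ} (hS : ∀ h : (ℝ ∙ x₀)ᗮ, ‖S h‖ = ‖T' h‖) {m : ℝ} (hm : 0 < m)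
    (hSm : ∀ h : (ℝ ∙ x₀)ᗮ, m * ‖h‖ ≤ ‖S h‖) {c : ℝ} (hc : 1 < c) :
    ∃ U : Set E, IsOpen U ∧ x₀ ∈ U ∧ ∀ x ∈ U ∩ sphere (0 : E) 1, ∀ y ∈ U ∩ sphere (0 : E) 1,
      ‖T x - T y‖ ≤ c * ‖S ((ℝ ∙ x₀)ᗮ.orthogonalProjectionOnto (x - y))‖ ∧
      ‖S ((ℝ ∙ x₀)ᗮ.orthogonalProjectionOnto (x - y))‖ ≤ c * ‖T x - T y‖ := by
  have hc' : 0 < 1 - c⁻¹ := by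
    have := inv_lt_one_of_one_lt₀ hc
    linarith
  obtain ⟨η, hη0, hη1, hη2⟩ : ∃ η : ℝ, 0 < η ∧ η ≤ 1 / 2 ∧
      2 * ((1 + ‖T'‖) * η) ≤ m * (1 - c⁻¹) := by
    have hM : 0 < 1 + ‖T'‖ := by positivity
    refine ⟨min (1 / 2) (m * (1 - c⁻¹) / (2 * (1 + ‖T'‖))), by positivity, min_le_left _ _, ?_⟩
    have := min_le_right (1 / 2) (m * (1 - c⁻¹) / (2 * (1 + ‖T'‖)))
    rw [le_div_iff₀ (by positivity)] at this
    linarith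
  have h1 := hT.isLittleO.def hη0
  rw [Metric.eventually_nhds_iff] at h1
  obtain ⟨ρ, hρ, h1⟩ := h1
  refine ⟨ball x₀ (min ρ η), isOpen_ball, mem_ball_self (lt_min hρ hη0), ?_⟩
  rintro x ⟨hxU, hxS⟩ y ⟨hyU, hyS⟩
  rw [mem_ball] at hxU hyU
  have hxy := @h1 (x, y) (by
    rw [Prod.dist_eq]
    exact max_lt (hxU.trans_le (min_le_left _ _)) (hyU.trans_le (min_le_left _ _)))
  have hx2 := hxU.trans_le (min_le_right _ _)
  have hy2 := hyU.trans_le (min_le_right _ _)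
  simp only at hxy
  rw [mem_sphere_zero_iff_norm] at hxS hyS
  set w := x - y with hw
  set h := (ℝ ∙ x₀)ᗮ.orthogonalProjectionOnto w with hh
  have hin : |⟪x₀, w⟫| ≤ η * ‖w‖ := by
    have e1 : 2 * ⟪x₀, w⟫ = ⟪(x₀ - x) + (x₀ - y), w⟫ := by
      have : ⟪x + y, x - y⟫ = 0 := by
        rw [real_inner_add_sub_eq_zero_iff, hxS, hyS]
      rw [← hw] at this
      have e2 : (x₀ - x) + (x₀ - y) = (2 : ℝ) • x₀ - (x + y) := by
        rw [two_smul]; abel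
      rw [e2, inner_sub_left, this, real_inner_smul_left]
      ring
    have e2 : |2 * ⟪x₀, w⟫| ≤ (η + η) * ‖w‖ := by
      rw [e1]
      refine (abs_real_inner_le_norm _ _).trans ?_
      gcongr
      refine (norm_add_le _ _).trans (add_le_add ?_ ?_)
      · rw [← dist_eq_norm, dist_comm]; exact hx2.le
      · rw [← dist_eq_norm, dist_comm]; exact hy2.le
    rw [abs_mul, abs_two] at e2
    linarith
  have hwh : w - (h : E) = ⟪x₀, w⟫ • x₀ := by
    have : (ℝ ∙ x₀).starProjection w + (ℝ ∙ x₀)ᗮ.starProjection w = w :=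
      Submodule.starProjection_add_starProjection_orthogonal _
    rw [Submodule.starProjection_unit_singleton ℝ hx₀] at this
    rw [sub_eq_iff_eq_add]
    exact this.symm
  have hwh' : ‖w - (h : E)‖ ≤ η * ‖w‖ := by
    rw [hwh, norm_smul, hx₀, mul_one]; exact hin
  have hT'wh : ‖T' w - T' h‖ ≤ ‖T'‖ * (η * ‖w‖) := by
    rw [← map_sub]
    exact (T'.le_opNorm _).trans (by gcongr)
  have hhw : ‖w‖ / 2 ≤ ‖h‖ := by
    have : ‖w‖ ≤ ‖w - (h : E)‖ + ‖(h : E)‖ := by simpa using norm_add_le (w - (h : E)) h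
    have h3 : η * ‖w‖ ≤ 1 / 2 * ‖w‖ := by gcongr
    rw [Submodule.coe_norm]
    linarith
  have hk : ‖T x - T y - T' h‖ ≤ (1 - c⁻¹) * ‖S h‖ := by
    have e1 : ‖T x - T y - T' h‖ ≤ ‖T x - T y - T' w‖ + ‖T' w - T' h‖ := by
      simpa using norm_add_le (T x - T y - T' w) (T' w - T' h)
    have e2 := hSm h
    have e3 : ‖T x - T y - T' h‖ ≤ (1 + ‖T'‖) * η * ‖w‖ := by linarith
    refine e3.trans ?_
    have e4 : 2 * ((1 + ‖T'‖) * η) * ‖w‖ ≤ m * (1 - c⁻¹) * ‖w‖ := by gcongr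
    have e5 : (1 - c⁻¹) * (m * (‖w‖ / 2)) ≤ (1 - c⁻¹) * ‖S h‖ := by
      gcongr
      exact (mul_le_mul_of_nonneg_left hhw hm.le).trans e2
    linarith
  have hub : ‖T x - T y‖ ≤ ‖T x - T y - T' h‖ + ‖T' h‖ := by
    simpa using norm_add_le (T x - T y - T' h) (T' h)
  have hlb : ‖T' h‖ ≤ ‖T x - T y - T' h‖ + ‖T x - T y‖ := by
    simpa [norm_sub_rev] using norm_add_le (T' h - (T x - T y)) (T x - T y)
  rw [← hS h] at hub hlb
  have hcc : c * c⁻¹ = 1 := mul_inv_cancel₀ (by linarith)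
  constructor
  · have : 2 - c⁻¹ ≤ c := by nlinarith [inv_pos.2 (zero_lt_one.trans hc), sq_nonneg (c - 1)]
    calc _ ≤ (2 - c⁻¹) * ‖S h‖ := by linarith
      _ ≤ _ := by gcongr
  · have e1 : c⁻¹ * ‖S h‖ ≤ ‖T x - T y‖ := by linarith
    calc ‖S h‖ = c * (c⁻¹ * ‖S h‖) := by rw [← mul_assoc, hcc, one_mul]
      _ ≤ _ := by gcongr

theorem finrank_orthogonal_singleton_euc {n : ℕ} {x₀ : Euc n} (hx₀ : ‖x₀‖ = 1) :
    (Module.finrank ℝ (ℝ ∙ x₀)ᗮ : ℝ) = (n : ℝ) - 1 := by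
  have h1 := Submodule.finrank_add_finrank_orthogonal (ℝ ∙ x₀)
  have h0 : x₀ ≠ 0 := by
    rintro rfl
    simp at hx₀
  rw [finrank_span_singleton h0, finrank_euclideanSpace_fin] at h1
  have h2 : (1 : ℝ) + Module.finrank ℝ (ℝ ∙ x₀)ᗮ = n := by exact_mod_cast h1
  linarith

theorem isAddHaarMeasure_hausdorffMeasure_orthogonal_singleton {n : ℕ} {x₀ : Euc n}
    (hx₀ : ‖x₀‖ = 1) :
    (μH[(n : ℝ) - 1] : Measure (ℝ ∙ x₀)ᗮ).IsAddHaarMeasure := by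
  rw [← finrank_orthogonal_singleton_euc hx₀]
  infer_instance

theorem exists_open_hausdorffMeasure_image_comparison {n : ℕ} (hn : 1 ≤ n) {T : Euc n → Euc n}
    {T' : Euc n →L[ℝ] Euc n} {x₀ : Euc n} (hx₀ : ‖x₀‖ = 1) (hT : HasStrictFDerivAt T T' x₀)
    {S : (ℝ ∙ x₀)ᗮ →ₗ[ℝ] (ℝ ∙ x₀)ᗮ} (hS : ∀ h : (ℝ ∙ x₀)ᗮ, ‖S h‖ = ‖T' h‖) {m : ℝ} (hm : 0 < m)
    (hSm : ∀ h : (ℝ ∙ x₀)ᗮ, m * ‖h‖ ≤ ‖S h‖) {c : NNReal} (hc : 1 < c) :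
    ∃ U : Set (Euc n), IsOpen U ∧ x₀ ∈ U ∧ ∀ A : Set (Euc n), A ⊆ U ∩ sphere (0 : Euc n) 1 →
      μH[(n : ℝ) - 1] (T '' A) ≤ ((c : ℝ≥0∞) ^ ((n : ℝ) - 1)) ^ 2 *
        (ENNReal.ofReal |LinearMap.det S| * μH[(n : ℝ) - 1] A) ∧
      ENNReal.ofReal |LinearMap.det S| * μH[(n : ℝ) - 1] A ≤
        ((c : ℝ≥0∞) ^ ((n : ℝ) - 1)) ^ 2 * μH[(n : ℝ) - 1] (T '' A) := by
  have hd : (0 : ℝ) ≤ (n : ℝ) - 1 := by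
    have : (1 : ℝ) ≤ n := by exact_mod_cast hn
    linarith
  have hcr : (1 : ℝ) < c := by exact_mod_cast hc
  have := isAddHaarMeasure_hausdorffMeasure_orthogonal_singleton hx₀
  obtain ⟨U, hU, hxU, h⟩ := exists_open_norm_sub_comparison hx₀ hT hS hm hSm hcr
  obtain ⟨U', hU', hxU', h'⟩ := exists_open_norm_sub_comparison (T := id)
    (T' := ContinuousLinearMap.id ℝ _) (S := LinearMap.id) hx₀ (hasStrictFDerivAt_id x₀)
    (fun h => by simp) one_pos (fun h => by simp) hcr
  refine ⟨U ∩ U', hU.inter hU', ⟨hxU, hxU'⟩, fun A hA => ?_⟩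
  set P := (ℝ ∙ x₀)ᗮ.orthogonalProjectionOnto
  have hAU : ∀ a ∈ A, a ∈ U ∩ sphere (0 : Euc n) 1 := fun a ha => ⟨(hA ha).1.1, (hA ha).2⟩
  have hAU' : ∀ a ∈ A, a ∈ U' ∩ sphere (0 : Euc n) 1 := fun a ha => ⟨(hA ha).1.2, (hA ha).2⟩
  have e1 : μH[(n : ℝ) - 1] (T '' A) ≤
      (c : ℝ≥0∞) ^ ((n : ℝ) - 1) * μH[(n : ℝ) - 1] ((fun a => S (P a)) '' A) :=
    hausdorffMeasure_image_le_of_dist_le hd fun a ha b hb => by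
      rw [dist_eq_norm, dist_eq_norm, ← map_sub, ← map_sub]
      exact (h a (hAU a ha) b (hAU b hb)).1
  have e2 : μH[(n : ℝ) - 1] ((fun a => S (P a)) '' A) ≤
      (c : ℝ≥0∞) ^ ((n : ℝ) - 1) * μH[(n : ℝ) - 1] (T '' A) :=
    hausdorffMeasure_image_le_of_dist_le hd fun a ha b hb => by
      rw [dist_eq_norm, dist_eq_norm, ← map_sub, ← map_sub]
      exact (h a (hAU a ha) b (hAU b hb)).2
  have e3 : μH[(n : ℝ) - 1] (id '' A) ≤
      (c : ℝ≥0∞) ^ ((n : ℝ) - 1) * μH[(n : ℝ) - 1] (P '' A) :=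
    hausdorffMeasure_image_le_of_dist_le hd fun a ha b hb => by
      rw [dist_eq_norm, dist_eq_norm, ← map_sub]
      exact (h' a (hAU' a ha) b (hAU' b hb)).1
  have e4 : μH[(n : ℝ) - 1] (P '' A) ≤
      (c : ℝ≥0∞) ^ ((n : ℝ) - 1) * μH[(n : ℝ) - 1] (id '' A) :=
    hausdorffMeasure_image_le_of_dist_le hd fun a ha b hb => by
      rw [dist_eq_norm, dist_eq_norm, ← map_sub]
      exact (h' a (hAU' a ha) b (hAU' b hb)).2
  rw [image_id] at e3 e4
  have e5 : μH[(n : ℝ) - 1] ((fun a => S (P a)) '' A) =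
      ENNReal.ofReal |LinearMap.det S| * μH[(n : ℝ) - 1] (P '' A) := by
    rw [← Measure.addHaar_image_linearMap, image_image]
  rw [e5] at e1 e2
  set q := (c : ℝ≥0∞) ^ ((n : ℝ) - 1)
  constructor
  · calc _ ≤ _ := e1
      _ ≤ q * (ENNReal.ofReal |LinearMap.det S| * (q * μH[(n : ℝ) - 1] A)) := by gcongr
      _ = _ := by ring
  · calc _ ≤ ENNReal.ofReal |LinearMap.det S| * (q * μH[(n : ℝ) - 1] (P '' A)) := by gcongr
      _ = q * (ENNReal.ofReal |LinearMap.det S| * μH[(n : ℝ) - 1] (P '' A)) := by ring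
      _ ≤ q * (q * μH[(n : ℝ) - 1] (T '' A)) := by gcongr
      _ = _ := by ring

theorem hausdorffMeasure_sphere_lt_top {n : ℕ} (hn : 1 ≤ n) :
    μH[(n : ℝ) - 1] (sphere (0 : Euc n) 1) < ∞ := by
  refine (isCompact_sphere (0 : Euc n) 1).measure_lt_top_of_nhdsWithin fun x₀ hx => ?_
  have hx₀ : ‖x₀‖ = 1 := by simpa using hx
  have hd : (0 : ℝ) ≤ (n : ℝ) - 1 := by
    have : (1 : ℝ) ≤ n := by exact_mod_cast hn
    linarith
  have := isAddHaarMeasure_hausdorffMeasure_orthogonal_singleton hx₀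
  obtain ⟨U, hU, hxU, h⟩ := exists_open_norm_sub_comparison (T := id)
    (T' := ContinuousLinearMap.id ℝ _) (S := LinearMap.id) hx₀ (hasStrictFDerivAt_id x₀)
    (fun h => by simp) one_pos (fun h => by simp) (one_lt_two)
  refine ⟨U ∩ sphere (0 : Euc n) 1, 
    Filter.inter_mem (mem_nhdsWithin_of_mem_nhds (hU.mem_nhds hxU)) self_mem_nhdsWithin, ?_⟩
  set P := (ℝ ∙ x₀)ᗮ.orthogonalProjectionOnto
  have e3 : μH[(n : ℝ) - 1] (id '' (U ∩ sphere (0 : Euc n) 1)) ≤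
      ((2 : NNReal) : ℝ≥0∞) ^ ((n : ℝ) - 1) *
        μH[(n : ℝ) - 1] (P '' (U ∩ sphere (0 : Euc n) 1)) :=
    hausdorffMeasure_image_le_of_dist_le hd fun a ha b hb => by
      rw [dist_eq_norm, dist_eq_norm, ← map_sub]
      exact (h a ha b hb).1
  rw [image_id] at e3
  refine e3.trans_lt (ENNReal.mul_lt_top (ENNReal.rpow_lt_top_of_nonneg hd (by simp)) ?_)
  refine (measure_mono (image_mono inter_subset_right)).trans_lt ?_
  exact ((isCompact_sphere (0 : Euc n) 1).image P.continuous).measure_lt_top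

namespace StarBody

variable {n : ℕ} (K : StarBody n)

theorem one_add_u_pos (x : Euc n) : 0 < 1 + K.u x := by
  linarith [K.gtNegOne x]

theorem contDiffAt_u {x : Euc n} (hx : x ≠ 0) : ContDiffAt ℝ (⊤ : ℕ∞) K.u x :=
  K.smooth.contDiffAt (isOpen_ne.mem_nhds hx)

theorem hasGradientAt_u {x : Euc n} (hx : x ≠ 0) : HasGradientAt K.u (gradient K.u x) x :=
  ((K.contDiffAt_u hx).differentiableAt (by simp)).hasGradientAt

theorem hasFDerivAt_u {x : Euc n} (hx : x ≠ 0) :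
    HasFDerivAt K.u (innerSL ℝ (gradient K.u x)) x :=
  (K.hasGradientAt_u hx).hasFDerivAt

theorem contDiffAt_gradient_u {x : Euc n} (hx : x ≠ 0) :
    ContDiffAt ℝ (⊤ : ℕ∞) (gradient K.u) x := by
  have h : ContDiffAt ℝ (⊤ : ℕ∞) (fderiv ℝ K.u) x :=
    (K.contDiffAt_u hx).fderiv_right (by simp)
  exact ((InnerProductSpace.toDual ℝ (Euc n)).symm.toContinuousLinearEquiv.contDiff.contDiffAt).comp
    x h

theorem differentiableAt_gradient_u {x : Euc n} (hx : x ≠ 0) :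
    DifferentiableAt ℝ (gradient K.u) x :=
  (K.contDiffAt_gradient_u hx).differentiableAt (by simp)

theorem inner_gradient_u_self {x : Euc n} (hx : x ≠ 0) : ⟪gradient K.u x, x⟫ = 0 := by
  have h1 : HasDerivAt (fun t : ℝ => K.u (t • x)) ⟪gradient K.u x, x⟫ 1 := by
    have h2 : HasDerivAt (fun t : ℝ => t • x) x 1 := by
      simpa using (hasDerivAt_id (1 : ℝ)).smul_const x
    have h3 : HasFDerivAt K.u (innerSL ℝ (gradient K.u x)) ((1 : ℝ) • x) := by
      rw [one_smul]
      exact K.hasFDerivAt_u hx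
    exact h3.comp_hasDerivAt (1 : ℝ) h2
  have h2 : HasDerivAt (fun t : ℝ => K.u (t • x)) 0 1 := by
    refine (hasDerivAt_const (1 : ℝ) (K.u x)).congr_of_eventuallyEq ?_
    filter_upwards [lt_mem_nhds (zero_lt_one' ℝ)] with t ht using K.homog x hx t ht
  exact h1.unique h2

/-- The Jacobian of the map `T` of the unit sphere onto `∂K`. -/
def jacobian (x : Euc n) : ℝ :=
  (1 + K.u x) ^ (n - 2) * √((1 + K.u x) ^ 2 + ‖gradient K.u x‖ ^ 2)

theorem jacobian_pos (x : Euc n) : 0 < K.jacobian x := by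
  have := K.one_add_u_pos x
  unfold jacobian
  positivity

theorem hasStrictFDerivAt_T {x : Euc n} (hx : x ≠ 0) :
    HasStrictFDerivAt K.T ((1 + K.u x) • ContinuousLinearMap.id ℝ (Euc n) +
      (innerSL ℝ (gradient K.u x)).smulRight x) x := by
  have h1 : HasStrictFDerivAt K.u (innerSL ℝ (gradient K.u x)) x := by
    have := (K.contDiffAt_u hx).hasStrictFDerivAt (by simp)
    rwa [(K.hasFDerivAt_u hx).fderiv] at this
  exact (h1.const_add 1).smul (hasStrictFDerivAt_id x)

theorem exists_tangentMap (hn : 2 ≤ n) {x : Euc n} (hx : ‖x‖ = 1) :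
    ∃ S : (ℝ ∙ x)ᗮ →ₗ[ℝ] (ℝ ∙ x)ᗮ,
      (∀ h : (ℝ ∙ x)ᗮ, ‖S h‖ = ‖((1 + K.u x) • ContinuousLinearMap.id ℝ (Euc n) +
        (innerSL ℝ (gradient K.u x)).smulRight x) h‖) ∧
      (∀ h : (ℝ ∙ x)ᗮ, (1 + K.u x) * ‖h‖ ≤ ‖S h‖) ∧ LinearMap.det S = K.jacobian x := by
  have hx0 : x ≠ 0 := by
    rintro rfl
    simp at hx
  have hr := K.one_add_u_pos x
  have hJ : K.jacobian x =
    (1 + K.u x) ^ (n - 2) * √((1 + K.u x) ^ 2 + ‖gradient K.u x‖ ^ 2) := rfl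
  have hgx := K.inner_gradient_u_self hx0
  set r := 1 + K.u x
  set g : Euc n := gradient K.u x
  obtain ⟨W, hW⟩ : ∃ W, W = √(r ^ 2 + ‖g‖ ^ 2) := ⟨_, rfl⟩
  have hW2 : W ^ 2 = r ^ 2 + ‖g‖ ^ 2 := by rw [hW, Real.sq_sqrt (by positivity)]
  have hW0 : 0 < W := by rw [hW]; positivity
  rw [← hW] at hJ
  have hgV : g ∈ (ℝ ∙ x)ᗮ := Submodule.mem_orthogonal_singleton_iff_inner_left.2 hgx
  obtain ⟨gV, hgV'⟩ : ∃ gV : (ℝ ∙ x)ᗮ, (gV : Euc n) = g := ⟨⟨g, hgV⟩, rfl⟩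
  have hgn : ‖gV‖ = ‖g‖ := by rw [← hgV', Submodule.coe_norm]
  obtain ⟨f, hf⟩ : ∃ f : Module.Dual ℝ (ℝ ∙ x)ᗮ, ∀ h, f h = (r * (r + W))⁻¹ * ⟪gV, h⟫ :=
    ⟨(r * (r + W))⁻¹ • (innerSL ℝ gV).toLinearMap, fun h => by simp⟩
  have hS : ∀ h, (r • LinearMap.transvection f gV) h = r • h + ((r + W)⁻¹ * ⟪gV, h⟫) • gV := by
    intro h
    rw [LinearMap.smul_apply, LinearMap.transvection.apply, smul_add, smul_smul, hf]
    congr 2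
    field_simp
  have hSn : ∀ h, ‖(r • LinearMap.transvection f gV) h‖ ^ 2 = r ^ 2 * ‖h‖ ^ 2 + ⟪gV, h⟫ ^ 2 := by
    intro h
    rw [hS, norm_add_sq_real, norm_smul, norm_smul, real_inner_smul_left, real_inner_smul_right,
      real_inner_comm gV h, mul_pow, mul_pow, hgn, Real.norm_eq_abs, Real.norm_eq_abs, sq_abs,
      sq_abs]
    have : ‖g‖ ^ 2 = W ^ 2 - r ^ 2 := by linarith
    rw [this]
    field_simp
    ring
  refine ⟨r • LinearMap.transvection f gV, fun h => ?_, fun h => ?_, ?_⟩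
  · rw [← sq_eq_sq₀ (norm_nonneg _) (norm_nonneg _), hSn]
    have hhx : ⟪(h : Euc n), x⟫ = 0 := Submodule.mem_orthogonal_singleton_iff_inner_left.1 h.2
    have : ⟪gV, h⟫ = ⟪g, (h : Euc n)⟫ := by rw [← hgV', Submodule.coe_inner]
    simp only [_root_.add_apply, _root_.smul_apply,
      ContinuousLinearMap.id_apply, ContinuousLinearMap.smulRight_apply, innerSL_apply_apply]
    rw [norm_add_sq_real, norm_smul, norm_smul, real_inner_smul_left, real_inner_smul_right, hhx,
      hx, this, mul_pow, Real.norm_eq_abs, Real.norm_eq_abs, mul_one, sq_abs, sq_abs]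
    simp
  · rw [← sq_le_sq₀ (by positivity) (norm_nonneg _), hSn, mul_pow]
    nlinarith [sq_nonneg ⟪gV, h⟫]
  · have hdim : Module.finrank ℝ (ℝ ∙ x)ᗮ = n - 2 + 1 := by
      have := finrank_orthogonal_singleton_euc hx
      have h2 : ((n - 2 + 1 : ℕ) : ℝ) = (n : ℝ) - 1 := by
        push_cast [Nat.cast_sub hn]
        ring
      exact_mod_cast this.trans h2.symm
    rw [LinearMap.det_smul, LinearMap.transvection.det, hJ, hf, real_inner_self_eq_norm_sq, hgn,
      hdim, pow_succ]
    have : ‖g‖ ^ 2 = W ^ 2 - r ^ 2 := by linarith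
    rw [this]
    field_simp
    ring

end StarBody

namespace StarBody

variable {n : ℕ} (K : StarBody n)

theorem ne_zero_of_mem_sphere {x : Euc n} (hx : x ∈ sphere (0 : Euc n) 1) : x ≠ 0 := by
  rintro rfl
  simp at hx

theorem continuousAt_jacobian {x : Euc n} (hx : x ≠ 0) : ContinuousAt K.jacobian x := by
  have h1 := (K.contDiffAt_u hx).continuousAt
  have h2 := (K.contDiffAt_gradient_u hx).continuousAt
  unfold jacobian
  fun_prop

theorem u_T {x : Euc n} (hx : x ≠ 0) : K.u (K.T x) = K.u x :=
  K.homog x hx _ (K.one_add_u_pos x)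

theorem image_T_inter_sphere (A : Set (Euc n)) :
    K.T '' (A ∩ sphere (0 : Euc n) 1) = (fun y => ‖y‖⁻¹ • y) ⁻¹' A ∩ K.bdry := by
  ext y
  constructor
  · rintro ⟨x, ⟨hxA, hxS⟩, rfl⟩
    have hx0 := ne_zero_of_mem_sphere hxS
    have hr := K.one_add_u_pos x
    rw [mem_sphere_zero_iff_norm] at hxS
    have hn : ‖K.T x‖ = 1 + K.u x := by
      rw [T, norm_smul, hxS, mul_one, Real.norm_of_nonneg hr.le]
    refine ⟨?_, ?_, ?_⟩
    · rw [mem_preimage, hn, T, smul_smul, inv_mul_cancel₀ hr.ne', one_smul]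
      exact hxA
    · rw [← norm_pos_iff, hn]
      exact hr
    · rw [hn, K.u_T hx0]
  · rintro ⟨hyA, hy0, hy⟩
    have hyn : 0 < ‖y‖ := norm_pos_iff.2 hy0
    refine ⟨‖y‖⁻¹ • y, ⟨hyA, ?_⟩, ?_⟩
    · rw [mem_sphere_zero_iff_norm, norm_smul, norm_inv, norm_norm, inv_mul_cancel₀ hyn.ne']
    · rw [T, K.homog y hy0 _ (inv_pos.2 hyn), ← hy, smul_smul, mul_inv_cancel₀ hyn.ne', one_smul]

theorem image_T_sphere : K.T '' sphere (0 : Euc n) 1 = K.bdry := by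
  simpa using K.image_T_inter_sphere univ

theorem measurableSet_bdry : MeasurableSet K.bdry := by
  rw [← K.image_T_sphere]
  refine ((isCompact_sphere (0 : Euc n) 1).image_of_continuousOn fun x hx => ?_).measurableSet
  exact (K.hasStrictFDerivAt_T (ne_zero_of_mem_sphere hx)).hasFDerivAt.continuousAt.continuousWithinAt

theorem measurable_normalize : Measurable fun y : Euc n => ‖y‖⁻¹ • y := by
  fun_prop

theorem exists_open_jacobian_comparison (hn : 2 ≤ n) {x₀ : Euc n} (hx₀ : x₀ ∈ sphere (0 : Euc n) 1)
    {c : NNReal} (hc : 1 < c) :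
    ∃ U : Set (Euc n), IsOpen U ∧ x₀ ∈ U ∧ ∀ A : Set (Euc n), A ⊆ U ∩ sphere (0 : Euc n) 1 →
      MeasurableSet A →
      μH[(n : ℝ) - 1] (K.T '' A) ≤ ((c : ℝ≥0∞) ^ ((n : ℝ) - 1)) ^ 2 * c *
        ∫⁻ x in A, ENNReal.ofReal (K.jacobian x) ∂μH[(n : ℝ) - 1] ∧
      ∫⁻ x in A, ENNReal.ofReal (K.jacobian x) ∂μH[(n : ℝ) - 1] ≤
        ((c : ℝ≥0∞) ^ ((n : ℝ) - 1)) ^ 2 * c * μH[(n : ℝ) - 1] (K.T '' A) := by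
  have hx0 := ne_zero_of_mem_sphere hx₀
  have hx1 : ‖x₀‖ = 1 := by simpa using hx₀
  have hcr : (1 : ℝ) < c := by exact_mod_cast hc
  obtain ⟨S, hS, hSm, hdet⟩ := K.exists_tangentMap hn hx1
  obtain ⟨U, hUo, hxU, hU⟩ := exists_open_hausdorffMeasure_image_comparison (by omega) hx1
    (K.hasStrictFDerivAt_T hx0) hS (K.one_add_u_pos x₀) hSm hc
  have hJ := K.jacobian_pos x₀
  have h1 : ∀ᶠ x in nhds x₀, K.jacobian x < c * K.jacobian x₀ :=
    (K.continuousAt_jacobian hx0).eventually_lt_const (by nlinarith)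
  have h2 : ∀ᶠ x in nhds x₀, K.jacobian x₀ < c * K.jacobian x :=
    (continuousAt_const.mul (K.continuousAt_jacobian hx0)).eventually_const_lt
      (show K.jacobian x₀ < c * K.jacobian x₀ by nlinarith)
  obtain ⟨V, hV, hVo, hxV⟩ := _root_.eventually_nhds_iff.1 (h1.and h2)
  refine ⟨U ∩ V, hUo.inter hVo, ⟨hxU, hxV⟩, fun A hA hAm => ?_⟩
  obtain ⟨hA1, hA2⟩ := hU A fun x hx => ⟨(hA hx).1.1, (hA hx).2⟩
  rw [hdet, abs_of_pos hJ] at hA1 hA2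
  set q := ((c : ℝ≥0∞) ^ ((n : ℝ) - 1)) ^ 2
  have hcE : ENNReal.ofReal (c : ℝ) = c := ENNReal.ofReal_coe_nnreal
  have e1 : ENNReal.ofReal (K.jacobian x₀) * μH[(n : ℝ) - 1] A ≤
      c * ∫⁻ x in A, ENNReal.ofReal (K.jacobian x) ∂μH[(n : ℝ) - 1] := by
    rw [← lintegral_const_mul' _ _ ENNReal.coe_ne_top, ← setLIntegral_const]
    refine setLIntegral_mono' hAm fun x hx => ?_
    rw [← hcE, ← ENNReal.ofReal_mul c.coe_nonneg]
    exact ENNReal.ofReal_le_ofReal (hV x (hA hx).1.2).2.le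
  have e2 : ∫⁻ x in A, ENNReal.ofReal (K.jacobian x) ∂μH[(n : ℝ) - 1] ≤
      c * (ENNReal.ofReal (K.jacobian x₀) * μH[(n : ℝ) - 1] A) := by
    rw [← mul_assoc, ← setLIntegral_const]
    refine setLIntegral_mono' hAm fun x hx => ?_
    rw [← hcE, ← ENNReal.ofReal_mul c.coe_nonneg]
    exact ENNReal.ofReal_le_ofReal (hV x (hA hx).1.2).1.le
  constructor
  · calc _ ≤ _ := hA1
      _ ≤ q * (c * ∫⁻ x in A, ENNReal.ofReal (K.jacobian x) ∂μH[(n : ℝ) - 1]) := by gcongr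
      _ = _ := by ring
  · calc _ ≤ _ := e2
      _ ≤ c * (q * μH[(n : ℝ) - 1] (K.T '' A)) := by gcongr
      _ = _ := by ring

theorem le_of_forall_one_lt_le_rpow_mul {d : ℝ} {a b : ℝ≥0∞}
    (h : ∀ c : NNReal, 1 < c → a ≤ ((c : ℝ≥0∞) ^ d) ^ 2 * c * b) : a ≤ b := by
  have h1 : Filter.Tendsto (fun c : NNReal => ((c : ℝ≥0∞) ^ d) ^ 2 * c * b)
      (nhdsWithin 1 (Ioi 1)) (nhds (((1 : ℝ≥0∞) ^ d) ^ 2 * 1 * b)) := by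
    have h2 : Filter.Tendsto (fun c : NNReal => (c : ℝ≥0∞)) (nhdsWithin 1 (Ioi 1)) (nhds 1) :=
      (ENNReal.continuous_coe.tendsto' 1 1 (by simp)).mono_left nhdsWithin_le_nhds
    have h3 : Filter.Tendsto (fun c : NNReal => ((c : ℝ≥0∞) ^ d) ^ 2)
        (nhdsWithin 1 (Ioi 1)) (nhds (((1 : ℝ≥0∞) ^ d) ^ 2)) :=
      ((ENNReal.continuous_pow 2).tendsto _).comp
        (((ENNReal.continuous_rpow_const (y := d)).tendsto _).comp h2)
    exact ENNReal.Tendsto.mul_const (ENNReal.Tendsto.mul h3 (by simp) h2 (by simp)) (by simp)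
  simp only [ENNReal.one_rpow, one_pow, one_mul] at h1
  refine ge_of_tendsto h1 ?_
  filter_upwards [self_mem_nhdsWithin] with c hc using h c hc

/-- Area formula for the map `T` from the unit sphere onto `∂K`. -/
theorem map_hausdorffMeasure_restrict_bdry (hn : 2 ≤ n) :
    (μH[(n : ℝ) - 1].restrict K.bdry).map (fun y => ‖y‖⁻¹ • y) =
      (μH[(n : ℝ) - 1].restrict (sphere (0 : Euc n) 1)).withDensity
        fun x => ENNReal.ofReal (K.jacobian x) := by
  have hSm : MeasurableSet (sphere (0 : Euc n) 1) := isClosed_sphere.measurableSet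
  have hl : ∀ A, MeasurableSet A →
      (μH[(n : ℝ) - 1].restrict K.bdry).map (fun y => ‖y‖⁻¹ • y) A =
        μH[(n : ℝ) - 1] (K.T '' (A ∩ sphere (0 : Euc n) 1)) := fun A hA => by
    rw [Measure.map_apply measurable_normalize hA,
      Measure.restrict_apply (measurable_normalize hA), K.image_T_inter_sphere]
  have hr : ∀ A, MeasurableSet A →
      (μH[(n : ℝ) - 1].restrict (sphere (0 : Euc n) 1)).withDensity
        (fun x => ENNReal.ofReal (K.jacobian x)) A =
      ∫⁻ x in A ∩ sphere (0 : Euc n) 1, ENNReal.ofReal (K.jacobian x) ∂μH[(n : ℝ) - 1] :=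
    fun A hA => by rw [withDensity_apply _ hA, Measure.restrict_restrict hA]
  set ν := (μH[(n : ℝ) - 1].restrict K.bdry).map (fun y => ‖y‖⁻¹ • y)
  set ρ := (μH[(n : ℝ) - 1].restrict (sphere (0 : Euc n) 1)).withDensity
        (fun x => ENNReal.ofReal (K.jacobian x))
  ext A hA
  have hνA : ν A = ν (A ∩ sphere (0 : Euc n) 1) := by
    rw [hl A hA, hl _ (hA.inter hSm), inter_assoc, inter_self]
  have hρA : ρ A = ρ (A ∩ sphere (0 : Euc n) 1) := by
    rw [hr A hA, hr _ (hA.inter hSm), inter_assoc, inter_self]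
  rw [hνA, hρA]
  refine le_antisymm (le_of_forall_one_lt_le_rpow_mul (d := (n : ℝ) - 1) fun c hc => ?_)
    (le_of_forall_one_lt_le_rpow_mul (d := (n : ℝ) - 1) fun c hc => ?_)
  · rw [← smul_eq_mul, ← Measure.smul_apply]
    refine measure_le_of_locally_le (S := sphere (0 : Euc n) 1) (fun x hx => ?_)
      inter_subset_right (hA.inter hSm)
    obtain ⟨U, hUo, hxU, hU⟩ := K.exists_open_jacobian_comparison hn hx hc
    refine ⟨U, hUo, hxU, fun B hB hBm => ?_⟩
    rw [Measure.smul_apply, smul_eq_mul, hl B hBm, hr B hBm,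
      inter_eq_left.2 (hB.trans inter_subset_right)]
    exact (hU B hB hBm).1
  · rw [← smul_eq_mul, ← Measure.smul_apply]
    refine measure_le_of_locally_le (S := sphere (0 : Euc n) 1) (fun x hx => ?_)
      inter_subset_right (hA.inter hSm)
    obtain ⟨U, hUo, hxU, hU⟩ := K.exists_open_jacobian_comparison hn hx hc
    refine ⟨U, hUo, hxU, fun B hB hBm => ?_⟩
    rw [Measure.smul_apply, smul_eq_mul, hl B hBm, hr B hBm,
      inter_eq_left.2 (hB.trans inter_subset_right)]
    exact (hU B hB hBm).2

theorem integral_bdry_eq (hn : 2 ≤ n) {f e : Euc n → ℝ} (he : ContinuousOn e (sphere 0 1))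
    (hfe : ∀ x ∈ sphere (0 : Euc n) 1, f (K.T x) = e x) :
    ∫ y in K.bdry, f y ∂μH[(n : ℝ) - 1] =
      ∫ x in sphere (0 : Euc n) 1, K.jacobian x * e x ∂μH[(n : ℝ) - 1] := by
  have hSm : MeasurableSet (sphere (0 : Euc n) 1) := isClosed_sphere.measurableSet
  have hJm : AEMeasurable (fun x => ENNReal.ofReal (K.jacobian x))
      (μH[(n : ℝ) - 1].restrict (sphere (0 : Euc n) 1)) :=
    (ContinuousOn.aemeasurable (fun x hx => (K.continuousAt_jacobian
      (ne_zero_of_mem_sphere hx)).continuousWithinAt) hSm).ennreal_ofReal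
  calc _ = ∫ y in K.bdry, e (‖y‖⁻¹ • y) ∂μH[(n : ℝ) - 1] := by
        refine setIntegral_congr_fun K.measurableSet_bdry fun y hy => ?_
        have hy' : y ∈ K.T '' (univ ∩ sphere (0 : Euc n) 1) := by
          rwa [univ_inter, K.image_T_sphere]
        obtain ⟨x, ⟨-, hx⟩, rfl⟩ := hy'
        have hr := K.one_add_u_pos x
        have hn : ‖K.T x‖⁻¹ • K.T x = x := by
          rw [T, norm_smul, mem_sphere_zero_iff_norm.1 hx, mul_one, Real.norm_of_nonneg hr.le,
            smul_smul, inv_mul_cancel₀ hr.ne', one_smul]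
        simp only [hn, hfe x hx]
    _ = ∫ x, e x ∂(μH[(n : ℝ) - 1].restrict K.bdry).map (fun y => ‖y‖⁻¹ • y) := by
        rw [integral_map measurable_normalize.aemeasurable]
        rw [K.map_hausdorffMeasure_restrict_bdry hn]
        exact (he.aestronglyMeasurable hSm).mono_ac (withDensity_absolutelyContinuous _ _)
    _ = _ := by
        rw [K.map_hausdorffMeasure_restrict_bdry hn, integral_withDensity_eq_integral_toReal_smul₀
          hJm (Filter.Eventually.of_forall fun x => ENNReal.ofReal_lt_top)]
        refine integral_congr_ae (Filter.Eventually.of_forall fun x => ?_)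
        simp only [ENNReal.toReal_ofReal (K.jacobian_pos x).le, smul_eq_mul]

end StarBody

theorem norm_exp_skew_apply {E : Type*} [NormedAddCommGroup E] [InnerProductSpace ℝ E]
    [CompleteSpace E] {A : E →L[ℝ] E} (hA : ∀ x, ⟪A x, x⟫ = 0) (t : ℝ) (x : E) :
    ‖NormedSpace.exp (t • A) x‖ = ‖x‖ := by
  have hder : ∀ s : ℝ, HasDerivAt (fun s : ℝ => ‖NormedSpace.exp (s • A) x‖ ^ 2) 0 s := by
    intro s
    have h1 : HasDerivAt (fun s : ℝ => NormedSpace.exp (s • A) x)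
        (A (NormedSpace.exp (s • A) x)) s :=
      (ContinuousLinearMap.apply ℝ E x).hasFDerivAt.comp_hasDerivAt s
        (hasDerivAt_exp_smul_const' A s)
    have h2 := h1.norm_sq
    rwa [real_inner_comm, hA, mul_zero] at h2
  have hconst := is_const_of_deriv_eq_zero (fun s => (hder s).differentiableAt)
    (fun s => (hder s).deriv) t 0
  simp only [zero_smul, NormedSpace.exp_zero] at hconst
  exact (sq_eq_sq₀ (norm_nonneg _) (norm_nonneg _)).1 hconst

theorem setIntegral_sphere_comp_linearIsometryEquiv {n : ℕ} (d : ℝ) (e : Euc n ≃ₗᵢ[ℝ] Euc n)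
    (f : Euc n → ℝ) :
    ∫ x in sphere (0 : Euc n) 1, f (e x) ∂μH[d] = ∫ x in sphere (0 : Euc n) 1, f x ∂μH[d] := by
  have h1 := (e.toIsometryEquiv.measurePreserving_hausdorffMeasure d).setIntegral_preimage_emb
    e.toIsometryEquiv.toHomeomorph.measurableEmbedding f (sphere (0 : Euc n) 1)
  have h2 : e.toIsometryEquiv ⁻¹' sphere (0 : Euc n) 1 = sphere (0 : Euc n) 1 := by
    ext x
    simp
  rw [h2] at h1
  exact h1

theorem continuousOn_sphere_integrable {n : ℕ} (hn : 1 ≤ n) {f : Euc n → ℝ}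
    (hf : ContinuousOn f (sphere (0 : Euc n) 1)) :
    Integrable f (μH[(n : ℝ) - 1].restrict (sphere (0 : Euc n) 1)) :=
  hf.integrableOn_of_subset_isCompact (isCompact_sphere _ _) isClosed_sphere.measurableSet
    subset_rfl (hausdorffMeasure_sphere_lt_top hn).ne

/-- Derivatives along infinitesimal rotations have zero mean on the sphere. -/
theorem integral_sphere_fderiv_skew_eq_zero {n : ℕ} (hn : 1 ≤ n) {h : Euc n → ℝ}
    (hh : ∀ x, x ≠ 0 → ContDiffAt ℝ 1 h x) {A : Euc n →L[ℝ] Euc n} (hA : ∀ x, ⟪A x, x⟫ = 0) :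
    ∫ x in sphere (0 : Euc n) 1, fderiv ℝ h x (A x) ∂μH[(n : ℝ) - 1] = 0 := by
  have hSm : MeasurableSet (sphere (0 : Euc n) 1) := isClosed_sphere.measurableSet
  have hS0 : ∀ x ∈ sphere (0 : Euc n) 1, x ≠ 0 := fun x hx => StarBody.ne_zero_of_mem_sphere hx
  have hcont : ContinuousOn h (sphere (0 : Euc n) 1) := fun x hx =>
    (hh x (hS0 x hx)).continuousAt.continuousWithinAt
  have hcont' : ContinuousOn (fun x => fderiv ℝ h x (A x)) (sphere (0 : Euc n) 1) := fun x hx =>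
    (((hh x (hS0 x hx)).fderiv_right (m := 0) (by simp)).continuousAt.clm_apply
      A.continuous.continuousAt).continuousWithinAt
  obtain ⟨C, hC⟩ := (isCompact_sphere (0 : Euc n) 1).exists_bound_of_continuousOn hcont'
  set R : ℝ → Euc n → Euc n := fun t x => NormedSpace.exp (t • A) x
  have hRS : ∀ t, ∀ x ∈ sphere (0 : Euc n) 1, R t x ∈ sphere (0 : Euc n) 1 := fun t x hx => by
    rw [mem_sphere_zero_iff_norm] at hx ⊢
    rw [← hx]
    exact norm_exp_skew_apply hA t x
  have hRc : ∀ t, Continuous (R t) := fun t => (NormedSpace.exp (t • A)).continuous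
  have hR0 : ∀ x, R 0 x = x := fun x => by
    have h0 : (0 : ℝ) • A = 0 := zero_smul ℝ A
    change NormedSpace.exp ((0 : ℝ) • A) x = x
    rw [h0, NormedSpace.exp_zero]
    rfl
  have hconst : ∀ t, ∫ x in sphere (0 : Euc n) 1, h (R t x) ∂μH[(n : ℝ) - 1] =
      ∫ x in sphere (0 : Euc n) 1, h x ∂μH[(n : ℝ) - 1] := by
    intro t
    let L : Euc n →ₗᵢ[ℝ] Euc n := ⟨(NormedSpace.exp (t • A)).toLinearMap, norm_exp_skew_apply hA t⟩
    exact setIntegral_sphere_comp_linearIsometryEquiv _ (L.toLinearIsometryEquiv rfl) h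
  have hder := (hasDerivAt_integral_of_dominated_loc_of_deriv_le
    (μ := μH[(n : ℝ) - 1].restrict (sphere (0 : Euc n) 1)) (F := fun t x => h (R t x))
    (F' := fun t x => fderiv ℝ h (R t x) (A (R t x))) (x₀ := (0 : ℝ)) (s := univ)
    (bound := fun _ => C) Filter.univ_mem
    (Filter.Eventually.of_forall fun t =>
      (hcont.comp (hRc t).continuousOn (hRS t)).aestronglyMeasurable hSm)
    (continuousOn_sphere_integrable hn (hcont.comp (hRc 0).continuousOn (hRS 0)))
    ((hcont'.comp (hRc 0).continuousOn (hRS 0)).aestronglyMeasurable hSm)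
    ((ae_restrict_iff' hSm).2 (Filter.Eventually.of_forall fun x hx t _ => hC _ (hRS t x hx)))
    (continuousOn_sphere_integrable hn continuousOn_const)
    ((ae_restrict_iff' hSm).2 (Filter.Eventually.of_forall fun x hx t _ => by
      have h1 : HasDerivAt (fun s : ℝ => NormedSpace.exp (s • A) x)
          (A (NormedSpace.exp (t • A) x)) t :=
        (ContinuousLinearMap.apply ℝ (Euc n) x).hasFDerivAt.comp_hasDerivAt t
          (hasDerivAt_exp_smul_const' A t)
      exact ((hh _ (hS0 _ (hRS t x hx))).differentiableAt (by simp)).hasFDerivAt.comp_hasDerivAt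
        t h1))).2
  simp only [hconst, hR0] at hder
  exact hder.unique (hasDerivAt_const _ _)

/-- The divergence theorem for tangential vector fields on the sphere. -/
theorem integral_sphere_divg_eq_zero {n : ℕ} (hn : 1 ≤ n) {F : Euc n → Euc n}
    (hF : ∀ x, x ≠ 0 → ContDiffAt ℝ 1 F x) (hFx : ∀ x, x ≠ 0 → ⟪F x, x⟫ = 0) :
    ∫ x in sphere (0 : Euc n) 1, divg F x ∂μH[(n : ℝ) - 1] = 0 := by
  have hSm : MeasurableSet (sphere (0 : Euc n) 1) := isClosed_sphere.measurableSet
  have hS0 : ∀ x ∈ sphere (0 : Euc n) 1, x ≠ 0 := fun x hx => StarBody.ne_zero_of_mem_sphere hx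
  let b := stdOrthonormalBasis ℝ (Euc n)
  let h := fun i j (x : Euc n) => ⟪b i, x⟫ * ⟪b j, F x⟫
  let A := fun i j => (innerSL ℝ (b i)).smulRight (b j) - (innerSL ℝ (b j)).smulRight (b i)
  have hAx : ∀ i j x, A i j x = ⟪b i, x⟫ • b j - ⟪b j, x⟫ • b i := fun i j x => by simp [A]
  have hA : ∀ i j x, ⟪A i j x, x⟫ = 0 := fun i j x => by
    rw [hAx, inner_sub_left, real_inner_smul_left, real_inner_smul_left]
    ring
  have hh : ∀ i j x, x ≠ 0 → ContDiffAt ℝ 1 (h i j) x := fun i j x hx =>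
    (contDiffAt_const.inner ℝ contDiffAt_id).mul (contDiffAt_const.inner ℝ (hF x hx))
  have hhd : ∀ i j x, x ≠ 0 → ∀ k, fderiv ℝ (h i j) x k =
      ⟪b i, x⟫ * ⟪b j, fderiv ℝ F x k⟫ + ⟪b i, k⟫ * ⟪b j, F x⟫ := by
    intro i j x hx k
    have h1 : HasFDerivAt (fun x : Euc n => ⟪b i, x⟫) (innerSL ℝ (b i)) x :=
      (innerSL ℝ (b i)).hasFDerivAt
    have h2 : HasFDerivAt (fun x : Euc n => ⟪b j, F x⟫) ((innerSL ℝ (b j)).comp (fderiv ℝ F x)) x :=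
      (innerSL ℝ (b j)).hasFDerivAt.comp x ((hF x hx).differentiableAt (by simp)).hasFDerivAt
    have h3 : HasFDerivAt (h i j) _ x := h1.mul h2
    rw [h3.fderiv]
    simp
    ring
  have hsum : ∀ x ∈ sphere (0 : Euc n) 1,
      divg F x = ∑ i, ∑ j, fderiv ℝ (h i j) x (A i j x) := by
    intro x hx
    have hx0 := hS0 x hx
    have hx1 : ‖x‖ = 1 := by simpa using hx
    set D := fderiv ℝ F x with hD
    have hDx : ⟪D x, x⟫ = 0 := by
      have h1 : HasFDerivAt (fun y => ⟪F y, y⟫) _ x :=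
        ((hF x hx0).differentiableAt (by simp)).hasFDerivAt.inner ℝ (hasFDerivAt_id x)
      have h2 : HasFDerivAt (fun y => ⟪F y, y⟫) (0 : Euc n →L[ℝ] ℝ) x := by
        refine (hasFDerivAt_const (0 : ℝ) x).congr_of_eventuallyEq ?_
        filter_upwards [isOpen_ne.mem_nhds hx0] with y hy using hFx y hy
      have h3 := congrArg (fun L => L x) (h1.unique h2)
      simpa [hFx x hx0] using h3
    have hterm : ∀ i j, fderiv ℝ (h i j) x (A i j x) =
        ⟪b i, x⟫ ^ 2 * ⟪b j, D (b j)⟫ - ⟪b j, x⟫ * ⟪b j, D (⟪b i, x⟫ • b i)⟫ +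
        (⟪b i, x⟫ * (if i = j then 1 else 0) * ⟪b j, F x⟫ - ⟪x, b j⟫ * ⟪b j, F x⟫) := by
      intro i j
      have h1 : ⟪b i, b i⟫ = 1 := by simp
      rw [hhd i j x hx0, hAx, inner_sub_right, map_sub, inner_sub_right, map_smul, map_smul,
        map_smul, real_inner_smul_right, real_inner_smul_right, real_inner_smul_right,
        real_inner_smul_right, real_inner_smul_right, OrthonormalBasis.inner_eq_ite, h1,
        real_inner_comm (b j) x]
      ring
    have hnorm : ∑ i, ⟪b i, x⟫ ^ 2 = 1 := by
      have := b.sum_sq_inner_right x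
      rw [hx1] at this
      simpa using this
    have hFx' : ∑ j, ⟪x, b j⟫ * ⟪b j, F x⟫ = 0 := by
      rw [b.sum_inner_mul_inner, real_inner_comm, hFx x hx0]
    have e1 : ∑ i, ∑ j, ⟪b i, x⟫ ^ 2 * ⟪b j, D (b j)⟫ = divg F x := by
      rw [divg, LinearMap.trace_eq_sum_inner _ b, ← Finset.sum_mul_sum, hnorm, one_mul]
      rfl
    have e2 : ∑ i, ∑ j, ⟪b j, x⟫ * ⟪b j, D (⟪b i, x⟫ • b i)⟫ = 0 := by
      rw [Finset.sum_comm]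
      have : ∀ j, ∑ i, ⟪b j, x⟫ * ⟪b j, D (⟪b i, x⟫ • b i)⟫ = ⟪x, b j⟫ * ⟪b j, D x⟫ := by
        intro j
        rw [← Finset.mul_sum, ← inner_sum, ← map_sum, b.sum_repr', real_inner_comm]
      simp only [this]
      rw [b.sum_inner_mul_inner, real_inner_comm, hDx]
    have e3 : ∑ i, ∑ j, ⟪b i, x⟫ * (if i = j then 1 else 0) * ⟪b j, F x⟫ = 0 := by
      simp only [mul_ite, mul_one, mul_zero, ite_mul, zero_mul, Finset.sum_ite_eq, Finset.mem_univ,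
        if_true]
      simpa only [real_inner_comm] using hFx'
    simp only [hterm, Finset.sum_add_distrib, Finset.sum_sub_distrib, e1, e2, e3, hFx']
    simp
  rw [setIntegral_congr_fun hSm hsum]
  have hint : ∀ i j, Integrable (fun x => fderiv ℝ (h i j) x (A i j x))
      (μH[(n : ℝ) - 1].restrict (sphere (0 : Euc n) 1)) := fun i j =>
    continuousOn_sphere_integrable hn fun x hx =>
      (((hh i j x (hS0 x hx)).fderiv_right (m := 0) (by simp)).continuousAt.clm_apply
        (A i j).continuous.continuousAt).continuousWithinAt
  rw [integral_finsetSum _ fun i _ => integrable_finsetSum _ fun j _ => hint i j]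
  refine Finset.sum_eq_zero fun i _ => ?_
  rw [integral_finsetSum _ fun j _ => hint i j]
  exact Finset.sum_eq_zero fun j _ => integral_sphere_fderiv_skew_eq_zero hn (hh i j) (hA i j)

theorem hasFDerivAt_inv_norm_smul {E : Type*} [NormedAddCommGroup E] [InnerProductSpace ℝ E]
    {V : E → E} {D : E →L[ℝ] E} {y : E} (hV : HasFDerivAt V D y) (hV0 : V y ≠ 0) :
    HasFDerivAt (fun z => ‖V z‖⁻¹ • V z)
      (‖V y‖⁻¹ • D - (‖V y‖⁻¹ ^ 3 • (innerSL ℝ (V y)).comp D).smulRight (V y)) y := by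
  have hN : 0 < ‖V y‖ := norm_pos_iff.2 hV0
  have h1 : HasFDerivAt (fun z => ‖V z‖ ^ 2) _ y := hV.norm_sq
  have h2 : HasFDerivAt (fun z => √(‖V z‖ ^ 2)) _ y := h1.sqrt (by positivity)
  simp only [Real.sqrt_sq (norm_nonneg _)] at h2
  have h3 : HasFDerivAt (fun z => ‖V z‖⁻¹) _ y :=
    (hasDerivAt_inv hN.ne').comp_hasFDerivAt y h2
  refine (h3.smul hV).congr_fderiv ?_
  ext w
  simp
  rw [sub_eq_add_neg, ← neg_smul, ← neg_smul]
  congr 2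
  field_simp

theorem divg_inv_norm_smul {n : ℕ} {V : Euc n → Euc n} {y : Euc n}
    (hV : DifferentiableAt ℝ V y) (hV0 : V y ≠ 0) :
    divg (fun z => ‖V z‖⁻¹ • V z) y =
      ‖V y‖⁻¹ * divg V y - ‖V y‖⁻¹ ^ 3 * ⟪fderiv ℝ V y (V y), V y⟫ := by
  have h5 : ∀ (L : Euc n →L[ℝ] ℝ) (w : Euc n),
      LinearMap.trace ℝ (Euc n) (L.smulRight w).toLinearMap = L w := fun L w =>
    LinearMap.trace_smulRight L.toLinearMap w
  rw [divg, (hasFDerivAt_inv_norm_smul hV.hasFDerivAt hV0).fderiv,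
    ContinuousLinearMap.toLinearMap_sub, map_sub, h5, ContinuousLinearMap.toLinearMap_smul, map_smul]
  simp [divg, real_inner_comm]

theorem divg_sub {n : ℕ} {V W : Euc n → Euc n} {y : Euc n} (hV : DifferentiableAt ℝ V y)
    (hW : DifferentiableAt ℝ W y) : divg (fun z => V z - W z) y = divg V y - divg W y := by
  rw [divg, fderiv_fun_sub hV hW, ContinuousLinearMap.toLinearMap_sub, map_sub]
  rfl

theorem divg_inv_norm_smul_self {n : ℕ} {y : Euc n} (hy : y ≠ 0) :
    divg (fun z : Euc n => ‖z‖⁻¹ • z) y = ((n : ℝ) - 1) * ‖y‖⁻¹ := by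
  have h := divg_inv_norm_smul (V := fun z : Euc n => z) differentiableAt_id hy
  have hN : ‖y‖ ≠ 0 := norm_ne_zero_iff.2 hy
  have h1 : fderiv ℝ (fun z : Euc n => z) y = ContinuousLinearMap.id ℝ (Euc n) := fderiv_fun_id
  have h2 : LinearMap.trace ℝ (Euc n) (ContinuousLinearMap.id ℝ (Euc n)).toLinearMap = n := by
    change LinearMap.trace ℝ (Euc n) LinearMap.id = n
    rw [LinearMap.trace_id, finrank_euclideanSpace_fin]
  rw [h, divg, h1, h2, ContinuousLinearMap.id_apply, real_inner_self_eq_norm_sq]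
  field_simp

namespace StarBody

variable {n : ℕ} (K : StarBody n)

theorem gradient_u_smul {x : Euc n} (hx : x ≠ 0) {t : ℝ} (ht : 0 < t) :
    gradient K.u (t • x) = t⁻¹ • gradient K.u x := by
  have htx : t • x ≠ 0 := smul_ne_zero ht.ne' hx
  have h1 : HasFDerivAt (fun z => K.u (t • z))
      ((innerSL ℝ (gradient K.u (t • x))).comp (t • ContinuousLinearMap.id ℝ (Euc n))) x :=
    (K.hasFDerivAt_u htx).comp x ((hasFDerivAt_id x).const_smul t)
  have h2 : HasFDerivAt (fun z => K.u (t • z)) (innerSL ℝ (gradient K.u x)) x := by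
    refine (K.hasFDerivAt_u hx).congr_of_eventuallyEq ?_
    filter_upwards [isOpen_ne.mem_nhds hx] with z hz using K.homog z hz t ht
  refine ext_inner_right ℝ fun w => ?_
  have h3 := congrArg (fun L => L w) (h1.unique h2)
  simp only [ContinuousLinearMap.comp_apply, smul_apply, ContinuousLinearMap.id_apply,
    innerSL_apply_apply, real_inner_smul_right] at h3
  rw [real_inner_smul_left, ← h3]
  field_simp

theorem fderiv_gradient_u_smul {x : Euc n} (hx : x ≠ 0) {t : ℝ} (ht : 0 < t) :
    fderiv ℝ (gradient K.u) (t • x) = t⁻¹ ^ 2 • fderiv ℝ (gradient K.u) x := by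
  have htx : t • x ≠ 0 := smul_ne_zero ht.ne' hx
  have h1 : HasFDerivAt (fun z => gradient K.u (t • z))
      ((fderiv ℝ (gradient K.u) (t • x)).comp (t • ContinuousLinearMap.id ℝ (Euc n))) x :=
    (K.differentiableAt_gradient_u htx).hasFDerivAt.comp x ((hasFDerivAt_id x).const_smul t)
  have h2 : HasFDerivAt (fun z => gradient K.u (t • z))
      (t⁻¹ • fderiv ℝ (gradient K.u) x) x := by
    refine ((K.differentiableAt_gradient_u hx).hasFDerivAt.const_smul t⁻¹).congr_of_eventuallyEq ?_
    filter_upwards [isOpen_ne.mem_nhds hx] with z hz using K.gradient_u_smul hz ht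
  ext1 w
  have h3 := congrArg (fun L => t⁻¹ • L w) (h1.unique h2)
  simp only [ContinuousLinearMap.comp_apply, smul_apply,
    ContinuousLinearMap.id_apply, map_smul, smul_smul, inv_mul_cancel₀ ht.ne', one_smul] at h3
  rw [h3, smul_apply, sq]

theorem fderiv_gradient_u_self {x : Euc n} (hx : x ≠ 0) :
    fderiv ℝ (gradient K.u) x x = -gradient K.u x := by
  have h1 : HasDerivAt (fun t : ℝ => gradient K.u (t • x)) (fderiv ℝ (gradient K.u) x x) 1 := by
    have h2 : HasDerivAt (fun t : ℝ => t • x) x 1 := by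
      simpa using (hasDerivAt_id (1 : ℝ)).smul_const x
    have h3 : HasFDerivAt (gradient K.u) (fderiv ℝ (gradient K.u) x) ((1 : ℝ) • x) := by
      rw [one_smul]
      exact (K.differentiableAt_gradient_u hx).hasFDerivAt
    exact h3.comp_hasDerivAt (1 : ℝ) h2
  have h2 : HasDerivAt (fun t : ℝ => gradient K.u (t • x)) (-gradient K.u x) 1 := by
    have h3 : HasDerivAt (fun t : ℝ => t⁻¹ • gradient K.u x) _ 1 :=
      (hasDerivAt_inv one_ne_zero).smul_const (gradient K.u x)
    simp only [one_pow, inv_one, neg_smul, one_smul] at h3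
    refine h3.congr_of_eventuallyEq ?_
    filter_upwards [lt_mem_nhds (zero_lt_one' ℝ)] with t ht using K.gradient_u_smul hx ht
  exact h1.unique h2

theorem inner_fderiv_gradient_u_self {x : Euc n} (hx : x ≠ 0) (w : Euc n) :
    ⟪fderiv ℝ (gradient K.u) x w, x⟫ = -⟪gradient K.u x, w⟫ := by
  have h1 : HasFDerivAt (fun y => ⟪gradient K.u y, y⟫) _ x :=
    (K.differentiableAt_gradient_u hx).hasFDerivAt.inner ℝ (hasFDerivAt_id x)
  have h2 : HasFDerivAt (fun y => ⟪gradient K.u y, y⟫) (0 : Euc n →L[ℝ] ℝ) x := by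
    refine (hasFDerivAt_const (0 : ℝ) x).congr_of_eventuallyEq ?_
    filter_upwards [isOpen_ne.mem_nhds hx] with y hy using K.inner_gradient_u_self hy
  have h3 := congrArg (fun L => L w) (h1.unique h2)
  simp only [ContinuousLinearMap.comp_apply, ContinuousLinearMap.prod_apply,
    ContinuousLinearMap.id_apply, fderivInnerCLM_apply, zero_apply] at h3
  linarith

theorem gradient_Fdef {y : Euc n} (hy : y ≠ 0) :
    gradient K.Fdef y = ‖y‖⁻¹ • y - gradient K.u y := by
  have hN : 0 < ‖y‖ := norm_pos_iff.2 hy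
  have h1 : HasFDerivAt (fun z : Euc n => ‖z‖ ^ 2) _ y := (hasFDerivAt_id y).norm_sq
  have h2 : HasFDerivAt (fun z : Euc n => √(‖z‖ ^ 2)) _ y := h1.sqrt (by positivity)
  simp only [Real.sqrt_sq (norm_nonneg _)] at h2
  have h3 : HasFDerivAt K.Fdef _ y := h2.sub ((K.hasFDerivAt_u hy).const_add 1)
  refine HasGradientAt.gradient ?_
  rw [hasGradientAt_iff_hasFDerivAt]
  refine h3.congr_fderiv ?_
  ext w
  simp
  field_simp

theorem meanCurv_T {x : Euc n} (hx : ‖x‖ = 1) :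
    K.meanCurv (K.T x) =
      (1 + K.u x) / √((1 + K.u x) ^ 2 + ‖gradient K.u x‖ ^ 2) *
        (((n : ℝ) - 1) / (1 + K.u x) - lapl K.u x / (1 + K.u x) ^ 2) +
      ((1 + K.u x) / √((1 + K.u x) ^ 2 + ‖gradient K.u x‖ ^ 2)) ^ 3 *
        (‖gradient K.u x‖ ^ 2 / (1 + K.u x) ^ 3 +
          hessBil K.u x (gradient K.u x) (gradient K.u x) / (1 + K.u x) ^ 4) := by
  have hx0 : x ≠ 0 := by
    rintro rfl
    simp at hx
  have hr := K.one_add_u_pos x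
  set r := 1 + K.u x with hrdef
  set g := gradient K.u x with hg
  set V : Euc n → Euc n := fun z => ‖z‖⁻¹ • z - gradient K.u z with hV
  have hT : K.T x = r • x := rfl
  have hT0 : r • x ≠ 0 := smul_ne_zero hr.ne' hx0
  have hnT : ‖r • x‖ = r := by rw [norm_smul, hx, mul_one, Real.norm_of_nonneg hr.le]
  have hgx : ⟪g, x⟫ = 0 := K.inner_gradient_u_self hx0
  have hxx : ⟪x, x⟫ = 1 := by rw [real_inner_self_eq_norm_sq, hx, one_pow]
  have hgg : ⟪g, g⟫ = ‖g‖ ^ 2 := real_inner_self_eq_norm_sq g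
  have hVT : V (r • x) = x - r⁻¹ • g := by
    simp only [hV]
    rw [hnT, smul_smul, inv_mul_cancel₀ hr.ne', one_smul, K.gradient_u_smul hx0 hr]
  have hVsq : ‖V (r • x)‖ ^ 2 = (r ^ 2 + ‖g‖ ^ 2) / r ^ 2 := by
    rw [hVT, norm_sub_sq_real, real_inner_smul_right, real_inner_comm, hgx, hx, norm_smul,
      Real.norm_of_nonneg (inv_nonneg.2 hr.le)]
    field_simp
    ring
  have hVn : ‖V (r • x)‖⁻¹ = r / √(r ^ 2 + ‖g‖ ^ 2) := by
    rw [← Real.sqrt_sq (norm_nonneg (V (r • x))), hVsq, Real.sqrt_div' _ (by positivity),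
      Real.sqrt_sq hr.le, inv_div]
  have hV0 : V (r • x) ≠ 0 := by
    intro h
    rw [h, norm_zero] at hVsq
    have : 0 < (r ^ 2 + ‖g‖ ^ 2) / r ^ 2 := by positivity
    simp [← hVsq] at this
  have hnormal : K.normal =ᶠ[nhds (r • x)] fun z => ‖V z‖⁻¹ • V z := by
    filter_upwards [isOpen_ne.mem_nhds hT0] with z hz
    rw [normal, K.gradient_Fdef hz]
  have hP : HasFDerivAt (fun z : Euc n => ‖z‖⁻¹ • z) _ (r • x) :=
    hasFDerivAt_inv_norm_smul (hasFDerivAt_id (r • x)) hT0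
  have hU := K.differentiableAt_gradient_u hT0
  have hVd : HasFDerivAt V _ (r • x) := hP.sub hU.hasFDerivAt
  have hdV : divg V (r • x) = ((n : ℝ) - 1) / r - lapl K.u x / r ^ 2 := by
    rw [hV, divg_sub hP.differentiableAt hU, divg_inv_norm_smul_self hT0, hnT, lapl, divg,
      K.fderiv_gradient_u_smul hx0 hr, ContinuousLinearMap.toLinearMap_smul, map_smul, divg,
      smul_eq_mul]
    field_simp
  have hgDg : ⟪fderiv ℝ (gradient K.u) x g, x⟫ = -‖g‖ ^ 2 := by
    rw [K.inner_fderiv_gradient_u_self hx0, hgg]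
  have hDV : fderiv ℝ V (r • x) (V (r • x)) = r⁻¹ ^ 3 • fderiv ℝ (gradient K.u) x g := by
    rw [hVd.fderiv, hVT, K.fderiv_gradient_u_smul hx0 hr]
    simp only [hnT, sub_apply, smul_apply, ContinuousLinearMap.id_apply, map_sub, map_smul,
      ContinuousLinearMap.smulRight_apply, ContinuousLinearMap.comp_apply, innerSL_apply_apply,
      real_inner_comm g x, K.fderiv_gradient_u_self hx0, smul_eq_mul, hxx, hgx]
    rw [← hg]
    match_scalars <;> field_simp <;> ring
  have hVDV : ⟪fderiv ℝ V (r • x) (V (r • x)), V (r • x)⟫ =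
      -(‖g‖ ^ 2 / r ^ 3 + hessBil K.u x g g / r ^ 4) := by
    rw [hDV, hVT, real_inner_smul_left, inner_sub_right, real_inner_smul_right, hgDg, hessBil]
    field_simp
    ring
  rw [meanCurv, hT, divg, hnormal.fderiv_eq, ← divg, divg_inv_norm_smul hVd.differentiableAt hV0,
    hVDV, hdV, hVn]
  ring

theorem continuousOn_lapl : ContinuousOn (lapl K.u) {x : Euc n | x ≠ 0} := by
  intro x hx
  have h : ContinuousAt (fderiv ℝ (gradient K.u)) x :=
    ((K.contDiffAt_gradient_u hx).fderiv_right (m := 0) (by simp)).continuousAt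
  have h2 : Continuous fun L : Euc n →L[ℝ] Euc n => LinearMap.trace ℝ (Euc n) L.toLinearMap :=
    LinearMap.continuous_of_finiteDimensional
      ((LinearMap.trace ℝ (Euc n)).comp (ContinuousLinearMap.coeLM ℝ))
  exact (h2.continuousAt.comp h).continuousWithinAt

theorem continuousOn_gradient_u : ContinuousOn (gradient K.u) {x : Euc n | x ≠ 0} :=
  fun _ hx => (K.contDiffAt_gradient_u hx).continuousAt.continuousWithinAt

theorem continuousOn_hessBil_gradient_u :
    ContinuousOn (fun x => hessBil K.u x (gradient K.u x) (gradient K.u x))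
      {x : Euc n | x ≠ 0} := by
  intro x hx
  have h : ContinuousAt (fderiv ℝ (gradient K.u)) x :=
    ((K.contDiffAt_gradient_u hx).fderiv_right (m := 0) (by simp)).continuousAt
  have hg := (K.contDiffAt_gradient_u hx).continuousAt
  exact ((h.clm_apply hg).inner hg).continuousWithinAt

theorem integral_meanCurv_eq (hn : 3 ≤ n) :
    ∫ y in K.bdry, K.meanCurv y ∂μH[(n : ℝ) - 1] =
      ∫ x in sphere (0 : Euc n) 1, (((n : ℝ) - 1) * (1 + K.u x) ^ (n - 2) -
        (1 + K.u x) ^ (n - 3) * lapl K.u x +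
        (1 + K.u x) ^ (n - 2) * ‖gradient K.u x‖ ^ 2 /
          ((1 + K.u x) ^ 2 + ‖gradient K.u x‖ ^ 2) +
        (1 + K.u x) ^ (n - 3) * hessBil K.u x (gradient K.u x) (gradient K.u x) /
          ((1 + K.u x) ^ 2 + ‖gradient K.u x‖ ^ 2)) ∂μH[(n : ℝ) - 1] := by
  have hSm : MeasurableSet (sphere (0 : Euc n) 1) := isClosed_sphere.measurableSet
  have hS : sphere (0 : Euc n) 1 ⊆ {x | x ≠ 0} := fun x hx => ne_zero_of_mem_sphere hx
  have hu : ContinuousOn K.u (sphere (0 : Euc n) 1) := K.smooth.continuousOn.mono hS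
  have hg := K.continuousOn_gradient_u.mono hS
  have hl := K.continuousOn_lapl.mono hS
  have hh := K.continuousOn_hessBil_gradient_u.mono hS
  have hr : ∀ x, 0 < 1 + K.u x := K.one_add_u_pos
  have hs : ∀ x, 0 < √((1 + K.u x) ^ 2 + ‖gradient K.u x‖ ^ 2) := fun x => by
    have := hr x
    positivity
  rw [K.integral_bdry_eq (by omega) ?_
    fun x hx => K.meanCurv_T (mem_sphere_zero_iff_norm.1 hx)]
  · refine setIntegral_congr_fun hSm fun x _ => ?_
    obtain ⟨m, rfl⟩ : ∃ m, n = m + 3 := ⟨n - 3, by omega⟩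
    have h1 := hr x
    have h2 := hs x
    have h3 : (1 + K.u x) ^ 2 + ‖gradient K.u x‖ ^ 2 =
      √((1 + K.u x) ^ 2 + ‖gradient K.u x‖ ^ 2) ^ 2 := (Real.sq_sqrt (by positivity)).symm
    simp only [jacobian, show m + 3 - 2 = m + 1 by omega, show m + 3 - 3 = m by omega]
    set s := √((1 + K.u x) ^ 2 + ‖gradient K.u x‖ ^ 2)
    rw [h3]
    field_simp
    ring
  · have hs' := fun x => (hs x).ne'
    have hr' := fun x => (hr x).ne'
    fun_prop (disch := first | assumption | intros; simp [hr', hs'])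

end StarBody

namespace StarBody

variable {n : ℕ} (K : StarBody n)

theorem integral_pow_mul_lapl_add_eq_zero (hn : 3 ≤ n) :
    ∫ x in sphere (0 : Euc n) 1, ((1 + K.u x) ^ (n - 3) * lapl K.u x +
      ((n : ℝ) - 3) * (1 + K.u x) ^ (n - 4) * ‖gradient K.u x‖ ^ 2) ∂μH[(n : ℝ) - 1] = 0 := by
  have hF : ∀ x : Euc n, x ≠ 0 →
      ContDiffAt ℝ (⊤ : ℕ∞) (fun x => (1 + K.u x) ^ (n - 3) • gradient K.u x) x := fun x hx =>
    ((contDiffAt_const.add (K.contDiffAt_u hx)).pow _).smul (K.contDiffAt_gradient_u hx)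
  rw [← integral_sphere_divg_eq_zero (n := n) (by omega)
    (fun x hx => (hF x hx).of_le (by simp))
    (fun x hx => by rw [real_inner_smul_left, K.inner_gradient_u_self hx, mul_zero])]
  refine setIntegral_congr_fun isClosed_sphere.measurableSet fun x hx => ?_
  have hx0 : x ≠ 0 := ne_zero_of_mem_sphere hx
  have h1 : HasFDerivAt (fun x => (1 + K.u x) ^ (n - 3)) _ x :=
    ((K.hasFDerivAt_u hx0).const_add 1).pow (n - 3)
  have h2 : HasFDerivAt (fun x => (1 + K.u x) ^ (n - 3) • gradient K.u x) _ x :=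
    h1.smul (K.differentiableAt_gradient_u hx0).hasFDerivAt
  have h3 : ∀ (L : Euc n →L[ℝ] ℝ) (w : Euc n),
      LinearMap.trace ℝ (Euc n) (L.smulRight w).toLinearMap = L w := fun L w =>
    LinearMap.trace_smulRight L.toLinearMap w
  rw [divg, h2.fderiv, ContinuousLinearMap.toLinearMap_add, ContinuousLinearMap.toLinearMap_smul,
    map_add, map_smul, h3, smul_apply, innerSL_apply_apply, real_inner_self_eq_norm_sq, lapl, divg,
    show n - 4 = n - 3 - 1 by omega]
  simp only [smul_eq_mul, nsmul_eq_mul]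
  push_cast [hn]
  ring

end StarBody

theorem exists_continuous_one_add_pow_eq (m : ℕ) : ∃ q : ℝ → ℝ, Continuous q ∧ ∀ t : ℝ,
    (1 + t) ^ m = 1 + m * t + m * (m - 1) / 2 * t ^ 2 + t ^ 3 * q t := by
  induction m with
  | zero => exact ⟨fun _ => 0, continuous_const, fun t => by simp⟩
  | succ m ih =>
    obtain ⟨q, hq, h⟩ := ih
    refine ⟨fun t => m * (m - 1) / 2 + q t + t * q t, by fun_prop, fun t => ?_⟩
    rw [pow_succ, h]
    push_cast
    ring

theorem exists_pos_abs_remainder_le {n : ℕ} (hn : 3 ≤ n) {δ : ℝ} (hδ : 0 < δ) :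
    ∃ ε : ℝ, 0 < ε ∧ ∀ t s : ℝ, |t| < ε → |s| < ε →
      |((n : ℝ) - 1) * ((1 + t) ^ (n - 2) - 1 - ((n : ℝ) - 2) * t -
          ((n : ℝ) - 2) * ((n : ℝ) - 3) / 2 * t ^ 2) +
        (((n : ℝ) - 3) * (1 + t) ^ (n - 4) + (1 + t) ^ (n - 2) / ((1 + t) ^ 2 + s ^ 2) -
          ((n : ℝ) - 2)) * s ^ 2| ≤ δ * (t ^ 2 + s ^ 2) := by
  obtain ⟨q, hq, hqe⟩ := exists_continuous_one_add_pow_eq (n - 2)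
  have hA : ContinuousAt (fun p : ℝ × ℝ => ((n : ℝ) - 1) * (p.1 * q p.1)) (0, 0) := by
    fun_prop
  have hB : ContinuousAt (fun p : ℝ × ℝ => ((n : ℝ) - 3) * (1 + p.1) ^ (n - 4) +
      (1 + p.1) ^ (n - 2) / ((1 + p.1) ^ 2 + p.2 ^ 2) - ((n : ℝ) - 2)) (0, 0) := by
    fun_prop (disch := norm_num)
  have hA' := hA.eventually (ball_mem_nhds _ hδ)
  have hB' := hB.eventually (ball_mem_nhds _ hδ)
  obtain ⟨ε, hε, h⟩ := Metric.eventually_nhds_iff.1 (hA'.and hB')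
  refine ⟨ε, hε, fun t s ht hs => ?_⟩
  obtain ⟨h1, h2⟩ := @h (t, s) (by simpa [Prod.dist_eq] using ⟨ht, hs⟩)
  simp only [Real.dist_eq] at h1 h2
  rw [show ((n : ℝ) - 1) * (0 * q 0) = 0 by ring, sub_zero, abs_lt] at h1
  rw [show ((n : ℝ) - 3) * (1 + 0) ^ (n - 4) + (1 + 0) ^ (n - 2) / ((1 + 0) ^ 2 + 0 ^ 2) -
    ((n : ℝ) - 2) = 0 by norm_num; ring, sub_zero, abs_lt] at h2
  have h3 : ((n : ℝ) - 1) * ((1 + t) ^ (n - 2) - 1 - ((n : ℝ) - 2) * t -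
      ((n : ℝ) - 2) * ((n : ℝ) - 3) / 2 * t ^ 2) = ((n : ℝ) - 1) * (t * q t) * t ^ 2 := by
    rw [hqe t]
    push_cast [show 2 ≤ n by omega]
    ring
  have ht2 := sq_nonneg t
  have hs2 := sq_nonneg s
  rw [h3, abs_le]
  constructor <;> nlinarith

/-- For every `n ≥ 3` and `δ > 0` there is `ε₀ > 0` such that for every
bounded star-shaped domain `K ⊆ ℝⁿ` with smooth boundary and radial profile
`u : S^{n-1} → (-1, ∞)` with `‖u‖_{C¹} < ε₀`, one has
`| ∫_{∂K} H dH^{n-1} − (n−1)H^{n-1}(S^{n-1}) − (n−1)(n−2)∫ u − ((n−1)(n−2)(n−3)/2)∫ u²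
   − (n−2)∫ |∇u|² − ∫ (1+u)^{n-3} ∇²u[∇u,∇u]/((1+u)²+|∇u|²) | ≤ δ ∫ (u² + |∇u|²)`,
all unadorned integrals being over `S^{n-1}`. -/
theorem integral_mean_curvature_expansion (n : ℕ) (hn : 3 ≤ n) (δ : ℝ) (hδ : 0 < δ) :
    ∃ ε₀ : ℝ, 0 < ε₀ ∧ ∀ K : StarBody n,
      (∀ x ∈ sphere (0 : Euc n) 1, |K.u x| < ε₀ ∧ ‖gradient K.u x‖ < ε₀) →
      |(∫ y in K.bdry, K.meanCurv y ∂μH[(n : ℝ) - 1])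
          - ((n : ℝ) - 1) * (μH[(n : ℝ) - 1] (sphere (0 : Euc n) 1)).toReal
          - ((n : ℝ) - 1) * ((n : ℝ) - 2) * ∫ x in sphere (0 : Euc n) 1, K.u x ∂μH[(n : ℝ) - 1]
          - ((n : ℝ) - 1) * ((n : ℝ) - 2) * ((n : ℝ) - 3) / 2
              * ∫ x in sphere (0 : Euc n) 1, (K.u x) ^ 2 ∂μH[(n : ℝ) - 1]
          - ((n : ℝ) - 2) * ∫ x in sphere (0 : Euc n) 1, ‖gradient K.u x‖ ^ 2 ∂μH[(n : ℝ) - 1]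
          - ∫ x in sphere (0 : Euc n) 1,
              (1 + K.u x) ^ (n - 3)
                * hessBil K.u x (gradient K.u x) (gradient K.u x)
                / ((1 + K.u x) ^ 2 + ‖gradient K.u x‖ ^ 2) ∂μH[(n : ℝ) - 1]|
        ≤ δ * ∫ x in sphere (0 : Euc n) 1,
              ((K.u x) ^ 2 + ‖gradient K.u x‖ ^ 2) ∂μH[(n : ℝ) - 1] := by
  obtain ⟨ε, hε, hrem⟩ := exists_pos_abs_remainder_le hn hδ
  refine ⟨ε, hε, fun K hK => ?_⟩
  have hSm : MeasurableSet (sphere (0 : Euc n) 1) := isClosed_sphere.measurableSet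
  have hS : sphere (0 : Euc n) 1 ⊆ {x | x ≠ 0} := fun x hx => StarBody.ne_zero_of_mem_sphere hx
  have hu : ContinuousOn K.u (sphere (0 : Euc n) 1) := K.smooth.continuousOn.mono hS
  have hg := K.continuousOn_gradient_u.mono hS
  have hl := K.continuousOn_lapl.mono hS
  have hh := K.continuousOn_hessBil_gradient_u.mono hS
  have hr : ∀ x, 0 < 1 + K.u x := K.one_add_u_pos
  have hw : ∀ x, (1 + K.u x) ^ 2 + ‖gradient K.u x‖ ^ 2 ≠ 0 := fun x => by
    have := hr x
    positivity
  have hint : ∀ {f : Euc n → ℝ}, ContinuousOn f (sphere (0 : Euc n) 1) →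
      Integrable f (μH[(n : ℝ) - 1].restrict (sphere (0 : Euc n) 1)) :=
    fun hf => continuousOn_sphere_integrable (by omega) hf
  have hone : (μH[(n : ℝ) - 1] (sphere (0 : Euc n) 1)).toReal =
      ∫ _ in sphere (0 : Euc n) 1, (1 : ℝ) ∂μH[(n : ℝ) - 1] := by
    simp [Measure.real]
  have hi1 := hint (f := fun x => ((n : ℝ) - 1) * (1 + K.u x) ^ (n - 2) -
        (1 + K.u x) ^ (n - 3) * lapl K.u x +
        (1 + K.u x) ^ (n - 2) * ‖gradient K.u x‖ ^ 2 /
          ((1 + K.u x) ^ 2 + ‖gradient K.u x‖ ^ 2) +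
        (1 + K.u x) ^ (n - 3) * hessBil K.u x (gradient K.u x) (gradient K.u x) /
          ((1 + K.u x) ^ 2 + ‖gradient K.u x‖ ^ 2))
    (by fun_prop (disch := first | assumption | intros; simp [hw]))
  have hi2 := hint (f := fun x => (1 + K.u x) ^ (n - 3) * lapl K.u x +
      ((n : ℝ) - 3) * (1 + K.u x) ^ (n - 4) * ‖gradient K.u x‖ ^ 2)
    (by fun_prop (disch := first | assumption | intros; simp [hw]))
  have hi3 := hint (f := fun _ => (1 : ℝ)) continuousOn_const
  have hi4 := hint hu
  have hi5 := hint (f := fun x => K.u x ^ 2) (by fun_prop)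
  have hi6 := hint (f := fun x => ‖gradient K.u x‖ ^ 2) (by fun_prop)
  have hi7 := hint (f := fun x => (1 + K.u x) ^ (n - 3) *
      hessBil K.u x (gradient K.u x) (gradient K.u x) /
        ((1 + K.u x) ^ 2 + ‖gradient K.u x‖ ^ 2))
    (by fun_prop (disch := first | assumption | intros; simp [hw]))
  have hsub : ∀ {f g : Euc n → ℝ}, Integrable f (μH[(n : ℝ) - 1].restrict (sphere 0 1)) →
      Integrable g (μH[(n : ℝ) - 1].restrict (sphere 0 1)) →
      Integrable (fun x => f x - g x) (μH[(n : ℝ) - 1].restrict (sphere 0 1)) :=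
    fun hf hg => hf.sub hg
  have h1 := hi1.fun_add hi2
  have h2 := hsub h1 (hi3.const_mul ((n : ℝ) - 1))
  have h3 := hsub h2 (hi4.const_mul (((n : ℝ) - 1) * ((n : ℝ) - 2)))
  have h4 := hsub h3 (hi5.const_mul (((n : ℝ) - 1) * ((n : ℝ) - 2) * ((n : ℝ) - 3) / 2))
  have h5 := hsub h4 (hi6.const_mul ((n : ℝ) - 2))
  rw [K.integral_meanCurv_eq hn, ← add_zero (∫ x in sphere (0 : Euc n) 1, _ ∂_),
    ← K.integral_pow_mul_lapl_add_eq_zero hn, hone, ← integral_add hi1 hi2,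
    ← integral_const_mul, ← integral_const_mul, ← integral_const_mul, ← integral_const_mul,
    ← integral_sub h1 (hi3.const_mul _), ← integral_sub h2 (hi4.const_mul _),
    ← integral_sub h3 (hi5.const_mul _), ← integral_sub h4 (hi6.const_mul _),
    ← integral_sub h5 hi7, ← integral_const_mul, ← Real.norm_eq_abs]
  refine norm_integral_le_of_norm_le ((hi5.add hi6).const_mul δ)
    ((ae_restrict_iff' hSm).2 (Filter.Eventually.of_forall fun x hx => ?_))
  rw [Real.norm_eq_abs]
  refine le_trans (le_of_eq ?_) (hrem (K.u x) ‖gradient K.u x‖ (hK x hx).1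
    (by rw [abs_norm]; exact (hK x hx).2))
  congr 1
  ring
end
end
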